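/- arXiv:1805.09726 — 2 statements merged into one kernel-verified Lean document; each statement's English description precedes it below -/
import Mathlib

section
/- Let n ≥ 1 and let ψ₁, ψ₂ : B₁ → ℝ be C^{1,1} on B₁ (with Lipschitz constants of ∇ψ₁, ∇ψ₂ at most K₀) and ψ₁ ≤ ψ₂ on B₁. Let u : B₁ → ℝ be continuous with ψ₁ ≤ u ≤ ψ₂ on B₁, and suppose there is a measurable function g : B₁ → ℝ with |g| ≤ C₀ almost everywhere, g = 0 almost everywhere on the open set {x ∈ B₁ : ψ₁(x) < u(x) < ψ₂(x)}, such that g represents the distributional Laplacian of u on B₁. Then u is C^{1,1} on B_{1/2}, and the Lipschitz constant of ∇u on B_{1/2} is bounded by a constant depending only on n, C₀, K₀ and sup_{B₁}|u|. (This is the Laplacian instance of Theorem 2.1 of the paper, the unconstrained double obstacle problem.) -/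
open MeasureTheory Metric Set

noncomputable section

/-- The Laplacian of `φ : ℝⁿ → ℝ`: the sum of the pure second partial derivatives. -/
def lapl {n : ℕ} (φ : EuclideanSpace ℝ (Fin n) → ℝ) (x : EuclideanSpace ℝ (Fin n)) : ℝ :=
  ∑ i : Fin n,
    fderiv ℝ (fun y => fderiv ℝ φ y (EuclideanSpace.single i (1 : ℝ))) x
      (EuclideanSpace.single i (1 : ℝ))

/-- `g` represents the distributional Laplacian of `u` on the unit ball `B₁`:
`∫_{B₁} u Δφ = ∫_{B₁} g φ` for every smooth `φ` with compact support contained in `B₁`. -/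
def IsDistribLaplacian {n : ℕ} (u g : EuclideanSpace ℝ (Fin n) → ℝ) : Prop :=
  ∀ φ : EuclideanSpace ℝ (Fin n) → ℝ, ContDiff ℝ (⊤ : ℕ∞) φ → HasCompactSupport φ →
    tsupport φ ⊆ ball (0 : EuclideanSpace ℝ (Fin n)) 1 →
    ∫ x in ball (0 : EuclideanSpace ℝ (Fin n)) 1, u x * lapl φ x =
      ∫ x in ball (0 : EuclideanSpace ℝ (Fin n)) 1, g x * φ x

open Topology Filter

local notation "𝔼" n => EuclideanSpace ℝ (Fin n)

/-! ### The radial profiles -/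

/-- A smooth decreasing profile, positive on `(-∞, 1)` and zero on `[1, ∞)`. -/
def bumpProfile (t : ℝ) : ℝ := expNegInvGlue (1 - t)

/-- Minus twice the derivative of `bumpProfile`. -/
def kernelProfile (t : ℝ) : ℝ := 2 * ((1 - t)⁻¹ ^ 2 * expNegInvGlue (1 - t))

theorem bumpProfile_nonneg (t : ℝ) : 0 ≤ bumpProfile t := expNegInvGlue.nonneg _

theorem bumpProfile_of_one_le {t : ℝ} (ht : 1 ≤ t) : bumpProfile t = 0 :=
  expNegInvGlue.zero_of_nonpos (by linarith)

theorem contDiff_bumpProfile : ContDiff ℝ (⊤ : ℕ∞) bumpProfile :=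
  expNegInvGlue.contDiff.comp (contDiff_const.sub contDiff_id)

theorem kernelProfile_nonneg (t : ℝ) : 0 ≤ kernelProfile t := by
  have := expNegInvGlue.nonneg (1 - t)
  unfold kernelProfile; positivity

theorem kernelProfile_pos {t : ℝ} (ht : t < 1) : 0 < kernelProfile t := by
  have := expNegInvGlue.pos_of_pos (sub_pos.2 ht)
  have : 0 < (1 - t)⁻¹ := inv_pos.2 (sub_pos.2 ht)
  unfold kernelProfile; positivity

theorem kernelProfile_of_one_le {t : ℝ} (ht : 1 ≤ t) : kernelProfile t = 0 := by
  simp [kernelProfile, expNegInvGlue.zero_of_nonpos (show 1 - t ≤ 0 by linarith)]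

theorem contDiff_kernelProfile : ContDiff ℝ (⊤ : ℕ∞) kernelProfile := by
  have h := (expNegInvGlue.contDiff_polynomial_eval_inv_mul (n := ⊤)
    (Polynomial.X ^ 2)).comp (contDiff_const.sub contDiff_id : ContDiff ℝ _ fun t : ℝ => 1 - t)
  have h2 : ContDiff ℝ (⊤ : ℕ∞) fun t : ℝ => (1 - t)⁻¹ ^ 2 * expNegInvGlue (1 - t) := by
    simpa [Function.comp_def] using h
  exact contDiff_const.mul h2

theorem hasDerivAt_bumpProfile (t : ℝ) :
    HasDerivAt bumpProfile (-(kernelProfile t / 2)) t := by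
  have h := (expNegInvGlue.hasDerivAt_polynomial_eval_inv_mul 1 (1 - t)).comp_const_sub 1 t
  simp only [Polynomial.eval_one, one_mul, Polynomial.derivative_one, sub_zero, mul_one,
    Polynomial.eval_pow, Polynomial.eval_X] at h
  refine HasDerivAt.congr_deriv (f := bumpProfile) h ?_
  unfold kernelProfile; ring

theorem hasDerivAt_kernelProfile (t : ℝ) :
    HasDerivAt kernelProfile (deriv kernelProfile t) t :=
  (contDiff_kernelProfile.differentiable (by simp) t).hasDerivAt

theorem continuous_deriv_kernelProfile : Continuous (deriv kernelProfile) :=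
  contDiff_kernelProfile.continuous_deriv (by simp)

theorem exists_kernelProfile_le : ∃ A : ℝ, 0 < A ∧ ∀ t, 0 ≤ t → kernelProfile t ≤ A := by
  obtain ⟨A, hA⟩ := isCompact_Icc.exists_bound_of_continuousOn
    (s := Set.Icc (0 : ℝ) 1) contDiff_kernelProfile.continuous.continuousOn
  refine ⟨|A| + 1, by positivity, fun t ht => ?_⟩
  rcases le_total t 1 with h | h
  · have := hA t ⟨ht, h⟩
    rw [Real.norm_eq_abs] at this
    linarith [le_abs_self (kernelProfile t), le_abs_self A]
  · rw [kernelProfile_of_one_le h]; positivity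

theorem exists_le_kernelProfile :
    ∃ a : ℝ, 0 < a ∧ ∀ t, 0 ≤ t → t ≤ 1 / 4 → a ≤ kernelProfile t := by
  obtain ⟨x, hx, hmin⟩ := isCompact_Icc.exists_isMinOn (s := Set.Icc (0 : ℝ) (1 / 4))
    ⟨0, by norm_num⟩ contDiff_kernelProfile.continuous.continuousOn
  exact ⟨kernelProfile x, kernelProfile_pos (by linarith [hx.2]), fun t h0 h1 => hmin ⟨h0, h1⟩⟩

/-! ### Radial kernels -/

/-- The radial averaging kernel at scale `s`; its total mass does not depend on `s`. -/
def avgKernel (n : ℕ) (s : ℝ) (z : 𝔼 n) : ℝ := (s ^ n)⁻¹ * kernelProfile (‖z‖ ^ 2 / s ^ 2)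

/-- The total mass of `avgKernel`. -/
def kernelMass (n : ℕ) : ℝ := ∫ z : 𝔼 n, kernelProfile (‖z‖ ^ 2)

/-- The mass of the unscaled bump. -/
def bumpMass (n : ℕ) : ℝ := ∫ z : 𝔼 n, bumpProfile (‖z‖ ^ 2)

variable {n : ℕ}

theorem one_le_sq_div_sq {s a : ℝ} (hs : 0 < s) (h : s ≤ a) : 1 ≤ a ^ 2 / s ^ 2 := by
  rw [le_div_iff₀ (by positivity)]; nlinarith

theorem avgKernel_nonneg {s : ℝ} (hs : 0 < s) (z : 𝔼 n) : 0 ≤ avgKernel n s z :=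
  mul_nonneg (by positivity) (kernelProfile_nonneg _)

theorem avgKernel_of_le_norm {s : ℝ} (hs : 0 < s) {z : 𝔼 n} (hz : s ≤ ‖z‖) :
    avgKernel n s z = 0 := by
  rw [avgKernel, kernelProfile_of_one_le (one_le_sq_div_sq hs hz), mul_zero]

theorem contDiff_avgKernel (s : ℝ) : ContDiff ℝ (⊤ : ℕ∞) (avgKernel n s) :=
  contDiff_const.mul (contDiff_kernelProfile.comp ((contDiff_norm_sq ℝ).div_const _))

theorem integral_radial_scale (f : ℝ → ℝ) (y : 𝔼 n) {s : ℝ} (hs : 0 < s) :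
    ∫ t : 𝔼 n, f (‖t - y‖ ^ 2 / s ^ 2) = s ^ n * ∫ z : 𝔼 n, f (‖z‖ ^ 2) := by
  rw [integral_sub_right_eq_self (fun t : 𝔼 n => f (‖t‖ ^ 2 / s ^ 2)) y]
  have h := Measure.integral_comp_inv_smul volume (fun z : 𝔼 n => f (‖z‖ ^ 2)) s
  rw [finrank_euclideanSpace_fin, abs_of_pos (by positivity), smul_eq_mul] at h
  rw [← h]
  congr 1; ext t
  rw [norm_smul, norm_inv, Real.norm_of_nonneg hs.le, mul_pow, inv_pow, div_eq_inv_mul]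

theorem integral_avgKernel (y : 𝔼 n) {s : ℝ} (hs : 0 < s) :
    ∫ t, avgKernel n s (t - y) = kernelMass n := by
  simp only [avgKernel]
  rw [integral_const_mul, integral_radial_scale kernelProfile y hs, kernelMass,
    inv_mul_cancel_left₀ (by positivity)]

theorem hasCompactSupport_radial {f : ℝ → ℝ} (hf : ∀ t, 1 ≤ t → f t = 0) (y : 𝔼 n) {s : ℝ}
    (hs : 0 < s) : tsupport (fun t : 𝔼 n => f (‖t - y‖ ^ 2 / s ^ 2)) ⊆ closedBall y s := by
  refine closure_minimal (fun t ht => ?_) isClosed_closedBall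
  by_contra h
  rw [mem_closedBall, dist_eq_norm, not_le] at h
  exact ht (hf _ (one_le_sq_div_sq hs h.le))

theorem kernelMass_pos (n : ℕ) : 0 < kernelMass n := by
  have hc : Continuous fun z : 𝔼 n => kernelProfile (‖z‖ ^ 2) :=
    contDiff_kernelProfile.continuous.comp (by fun_prop)
  refine hc.integral_pos_of_hasCompactSupport_nonneg_nonzero (x := 0) ?_
    (fun z => kernelProfile_nonneg _) ?_
  · have h := hasCompactSupport_radial (n := n) (fun t => kernelProfile_of_one_le) 0 one_pos
    simp only [sub_zero, one_pow, div_one] at h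
    exact (isCompact_closedBall _ _).of_isClosed_subset (isClosed_tsupport _) h
  · simpa using (kernelProfile_pos one_pos).ne'

theorem bumpMass_nonneg (n : ℕ) : 0 ≤ bumpMass n :=
  integral_nonneg fun _ => bumpProfile_nonneg _

theorem hasFDerivAt_norm_sub_sq_div (y t : 𝔼 n) (s : ℝ) :
    HasFDerivAt (fun t : 𝔼 n => ‖t - y‖ ^ 2 / s ^ 2)
      ((s ^ 2)⁻¹ • (2 : ℝ) • innerSL ℝ (t - y)) t := by
  have h := ((hasFDerivAt_id t).sub_const y).norm_sq.const_mul (s ^ 2)⁻¹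
  simp only [id, ← div_eq_inv_mul] at h
  refine h.congr_fderiv ?_
  ext x; simp

theorem inner_single_eq (z : 𝔼 n) (i : Fin n) :
    inner ℝ z (EuclideanSpace.single i (1 : ℝ)) = z i := by
  rw [EuclideanSpace.inner_single_right]; simp

theorem lapl_bump (y t : 𝔼 n) (s : ℝ) :
    lapl (fun t : 𝔼 n => bumpProfile (‖t - y‖ ^ 2 / s ^ 2)) t =
      -((s ^ 2)⁻¹ * (2 * (s ^ 2)⁻¹ * deriv kernelProfile (‖t - y‖ ^ 2 / s ^ 2) * ‖t - y‖ ^ 2 +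
        n * kernelProfile (‖t - y‖ ^ 2 / s ^ 2))) := by
  have h1 : ∀ (i : Fin n) (x : 𝔼 n),
      fderiv ℝ (fun t : 𝔼 n => bumpProfile (‖t - y‖ ^ 2 / s ^ 2)) x
        (EuclideanSpace.single i (1 : ℝ)) =
      kernelProfile (‖x - y‖ ^ 2 / s ^ 2) * (-(s ^ 2)⁻¹ * (x i - y i)) := by
    intro i x
    have h := ((hasDerivAt_bumpProfile _).comp_hasFDerivAt x
      (hasFDerivAt_norm_sub_sq_div y x s))
    rw [HasFDerivAt.fderiv (f := fun t : 𝔼 n => bumpProfile (‖t - y‖ ^ 2 / s ^ 2)) h]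
    simp only [smul_apply, smul_eq_mul, innerSL_apply_apply, inner_single_eq]
    simp; ring
  unfold lapl
  simp only [h1]
  have h2 : ∀ i : Fin n,
      fderiv ℝ (fun x : 𝔼 n =>
        kernelProfile (‖x - y‖ ^ 2 / s ^ 2) * (-(s ^ 2)⁻¹ * (x i - y i))) t
        (EuclideanSpace.single i (1 : ℝ)) =
      -((s ^ 2)⁻¹ * (2 * (s ^ 2)⁻¹ * deriv kernelProfile (‖t - y‖ ^ 2 / s ^ 2) * (t - y) i ^ 2 +
        kernelProfile (‖t - y‖ ^ 2 / s ^ 2))) := by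
    intro i
    have ha := ((hasDerivAt_kernelProfile _).comp_hasFDerivAt t
      (hasFDerivAt_norm_sub_sq_div y t s))
    have hb : HasFDerivAt (fun x : 𝔼 n => -(s ^ 2)⁻¹ * (x i - y i))
        (-(s ^ 2)⁻¹ • (EuclideanSpace.proj i : (𝔼 n) →L[ℝ] ℝ)) t :=
      (((EuclideanSpace.proj i : (𝔼 n) →L[ℝ] ℝ).hasFDerivAt).sub_const (y i)).const_mul _
    have h := HasFDerivAt.mul ha hb
    rw [HasFDerivAt.fderiv (f := fun x : 𝔼 n =>
        kernelProfile (‖x - y‖ ^ 2 / s ^ 2) * (-(s ^ 2)⁻¹ * (x i - y i))) h]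
    simp only [add_apply, smul_apply, smul_eq_mul, innerSL_apply_apply, inner_single_eq,
      Function.comp]
    simp; ring
  simp only [h2]
  rw [Finset.sum_neg_distrib, ← Finset.mul_sum, Finset.sum_add_distrib, ← Finset.mul_sum,
    EuclideanSpace.real_norm_sq_eq (t - y)]
  simp

theorem hasDerivAt_avgKernel (y t : 𝔼 n) {s : ℝ} (hs : 0 < s) :
    HasDerivAt (fun s => avgKernel n s (t - y))
      (s * (s ^ n)⁻¹ * lapl (fun t : 𝔼 n => bumpProfile (‖t - y‖ ^ 2 / s ^ 2)) t) s := by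
  have hs' := hs.ne'
  have h1 : HasDerivAt (fun s : ℝ => (s ^ n)⁻¹) (-(n * (s ^ n)⁻¹ * s⁻¹)) s := by
    refine ((hasDerivAt_pow n s).inv (pow_ne_zero n hs')).congr_deriv ?_
    rcases n with _ | m
    · simp
    · simp only [Nat.add_sub_cancel]; field_simp; ring
  have h2 : HasDerivAt (fun s : ℝ => ‖t - y‖ ^ 2 / s ^ 2) (-(2 * ‖t - y‖ ^ 2 / s ^ 3)) s := by
    refine ((hasDerivAt_const s (‖t - y‖ ^ 2)).div (hasDerivAt_pow 2 s)
      (pow_ne_zero 2 hs')).congr_deriv ?_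
    field_simp; simp; ring
  have h := h1.mul ((hasDerivAt_kernelProfile _).comp s h2)
  refine HasDerivAt.congr_deriv (f := fun s => avgKernel n s (t - y)) h ?_
  rw [lapl_bump]
  simp only [Function.comp]
  field_simp
  ring

/-! ### The mean value inequality -/

theorem avgKernel_eq_zero_of_notMem {y t : 𝔼 n} {s : ℝ} (hs : 0 < s) (hy : ‖y‖ + s ≤ 1)
    (ht : t ∉ ball (0 : 𝔼 n) 1) : avgKernel n s (t - y) = 0 := by
  refine avgKernel_of_le_norm hs ?_
  rw [mem_ball_zero_iff, not_lt] at ht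
  linarith [norm_sub_norm_le t y]

theorem continuous_avgKernel_sub (s : ℝ) (y : 𝔼 n) :
    Continuous fun t => avgKernel n s (t - y) :=
  (contDiff_avgKernel s).continuous.comp (by fun_prop)

theorem hasCompactSupport_avgKernel_sub {s : ℝ} (hs : 0 < s) (y : 𝔼 n) :
    HasCompactSupport fun t => avgKernel n s (t - y) := by
  refine HasCompactSupport.intro (isCompact_closedBall y s) fun t ht => ?_
  refine avgKernel_of_le_norm hs ?_
  rw [mem_closedBall, dist_eq_norm, not_le] at ht
  exact ht.le

theorem integrable_avgKernel_sub {s : ℝ} (hs : 0 < s) (y : 𝔼 n) :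
    Integrable fun t => avgKernel n s (t - y) :=
  (continuous_avgKernel_sub s y).integrable_of_hasCompactSupport
    (hasCompactSupport_avgKernel_sub hs y)

theorem setIntegral_mul_avgKernel (f : (𝔼 n) → ℝ) {y : 𝔼 n} {s : ℝ} (hs : 0 < s)
    (hy : ‖y‖ + s ≤ 1) :
    ∫ t in ball (0 : 𝔼 n) 1, f t * avgKernel n s (t - y) = ∫ t, f t * avgKernel n s (t - y) :=
  setIntegral_eq_integral_of_forall_compl_eq_zero fun t ht => by
    rw [avgKernel_eq_zero_of_notMem hs hy ht, mul_zero]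

theorem setIntegral_const_mul_avgKernel (c : ℝ) {y : 𝔼 n} {s : ℝ} (hs : 0 < s)
    (hy : ‖y‖ + s ≤ 1) :
    ∫ t in ball (0 : 𝔼 n) 1, c * avgKernel n s (t - y) = kernelMass n * c := by
  rw [setIntegral_mul_avgKernel (fun _ => c) hs hy, integral_const_mul, integral_avgKernel y hs,
    mul_comm]

theorem integrable_mul_avgKernel {u : (𝔼 n) → ℝ} (hu : ContinuousOn u (ball 0 1)) {M : ℝ}
    (hM : ∀ x ∈ ball (0 : 𝔼 n) 1, |u x| ≤ M) {s : ℝ} (hs : 0 < s) (y : 𝔼 n) :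
    Integrable (fun t => u t * avgKernel n s (t - y)) (volume.restrict (ball (0 : 𝔼 n) 1)) := by
  refine (integrable_avgKernel_sub hs y).restrict.bdd_mul (c := M)
    (hu.aestronglyMeasurable measurableSet_ball) ?_
  exact (ae_restrict_iff' measurableSet_ball).2 (.of_forall fun x hx => hM x hx)

theorem hasDerivAt_average {u g : (𝔼 n) → ℝ} (hu : ContinuousOn u (ball 0 1)) {M : ℝ}
    (hM : ∀ x ∈ ball (0 : 𝔼 n) 1, |u x| ≤ M) (hug : IsDistribLaplacian u g)
    {y : 𝔼 n} {s : ℝ} (hs : 0 < s) (hy : ‖y‖ + s < 1) :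
    HasDerivAt (fun s => ∫ t in ball (0 : 𝔼 n) 1, u t * avgKernel n s (t - y))
      (s * (s ^ n)⁻¹ *
        ∫ t in ball (0 : 𝔼 n) 1, g t * bumpProfile (‖t - y‖ ^ 2 / s ^ 2)) s := by
  set F' : ℝ → (𝔼 n) → ℝ := fun s t =>
    s * (s ^ n)⁻¹ * lapl (fun t : 𝔼 n => bumpProfile (‖t - y‖ ^ 2 / s ^ 2)) t with hF'
  have hcont : ContinuousOn (fun p : ℝ × (𝔼 n) => F' p.1 p.2) (Ioi 0 ×ˢ univ) := by
    simp only [hF', lapl_bump]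
    have hq : ContinuousOn (fun p : ℝ × (𝔼 n) => ‖p.2 - y‖ ^ 2 / p.1 ^ 2) (Ioi 0 ×ˢ univ) :=
      ContinuousOn.div (by fun_prop) (by fun_prop) fun p hp => pow_ne_zero 2 (ne_of_gt hp.1)
    have hi : ∀ k : ℕ, ContinuousOn (fun p : ℝ × (𝔼 n) => (p.1 ^ k)⁻¹) (Ioi 0 ×ˢ univ) :=
      fun k => ContinuousOn.inv₀ (by fun_prop) fun p hp => pow_ne_zero k (ne_of_gt hp.1)
    have hk := contDiff_kernelProfile.continuous.comp_continuousOn hq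
    have hk' := continuous_deriv_kernelProfile.comp_continuousOn hq
    refine (continuousOn_fst.mul (hi n)).mul (((hi 2).mul
      ((((continuousOn_const.mul (hi 2)).mul hk').mul ?_).add (continuousOn_const.mul hk))).neg)
    fun_prop
  have hcont' : ∀ s, 0 < s → Continuous (F' s) := fun s hs =>
    hcont.comp_continuous (f := fun t => (s, t)) (by fun_prop) fun t => ⟨hs, mem_univ _⟩
  obtain ⟨B, hB⟩ := (isCompact_Icc.prod (isCompact_closedBall (0 : 𝔼 n) 1)).exists_bound_of_continuousOn
    (s := Icc (s / 2) (2 * s) ×ˢ closedBall (0 : 𝔼 n) 1)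
    (hcont.mono (prod_mono (fun x hx => lt_of_lt_of_le (by positivity) hx.1) (subset_univ _)))
  have hmeas : AEStronglyMeasurable u (volume.restrict (ball (0 : 𝔼 n) 1)) :=
    hu.aestronglyMeasurable measurableSet_ball
  have key := (hasDerivAt_integral_of_dominated_loc_of_deriv_le
    (μ := volume.restrict (ball (0 : 𝔼 n) 1)) (x₀ := s) (s := Icc (s / 2) (2 * s))
    (F := fun s t => u t * avgKernel n s (t - y)) (F' := fun s t => u t * F' s t)
    (bound := fun _ => M * B)
    (Icc_mem_nhds (by linarith) (by linarith))
    (.of_forall fun s => hmeas.mul (continuous_avgKernel_sub s y).aestronglyMeasurable)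
    (integrable_mul_avgKernel hu hM hs y)
    (hmeas.mul (hcont' s hs).aestronglyMeasurable)
    ((ae_restrict_iff' measurableSet_ball).2 (.of_forall fun t ht x hx => ?_))
    (integrableOn_const measure_ball_lt_top.ne)
    (.of_forall fun t x hx => ?_)).2
  · refine key.congr_deriv ?_
    simp only [hF']
    have hts := hasCompactSupport_radial (fun t => bumpProfile_of_one_le) y hs
    rw [← hug (fun t => bumpProfile (‖t - y‖ ^ 2 / s ^ 2))
      (contDiff_bumpProfile.comp (((contDiff_norm_sq ℝ).comp
        (contDiff_id.sub contDiff_const)).div_const _))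
      ((isCompact_closedBall _ _).of_isClosed_subset (isClosed_tsupport _) hts)
      (hts.trans fun t ht => ?_), ← integral_const_mul]
    · congr 1; ext t; ring
    · rw [mem_closedBall, dist_eq_norm] at ht
      rw [mem_ball_zero_iff]
      linarith [norm_sub_norm_le t y]
  · rw [norm_mul]
    have h1 := hM t ht
    exact mul_le_mul h1 (hB (x, t) ⟨hx, ball_subset_closedBall ht⟩) (norm_nonneg _)
      ((abs_nonneg _).trans h1)
  · exact (hasDerivAt_avgKernel y t (lt_of_lt_of_le (by positivity) hx.1)).const_mul (u t)

theorem abs_integral_mul_bump_le {g : (𝔼 n) → ℝ} {y : 𝔼 n} {s r C : ℝ} (hs : 0 < s)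
    (hsr : s ≤ r) (hg : ∀ᵐ x ∂(volume.restrict (ball y r)), |g x| ≤ C) (hC : 0 ≤ C) :
    |∫ t in ball (0 : 𝔼 n) 1, g t * bumpProfile (‖t - y‖ ^ 2 / s ^ 2)| ≤
      C * (s ^ n * bumpMass n) := by
  have hcont : Continuous fun t : 𝔼 n => bumpProfile (‖t - y‖ ^ 2 / s ^ 2) :=
    contDiff_bumpProfile.continuous.comp (by fun_prop)
  have hintble : Integrable fun t : 𝔼 n => bumpProfile (‖t - y‖ ^ 2 / s ^ 2) :=
    hcont.integrable_of_hasCompactSupport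
      ((isCompact_closedBall _ _).of_isClosed_subset (isClosed_tsupport _)
        (hasCompactSupport_radial (fun t => bumpProfile_of_one_le) y hs))
  calc |∫ t in ball (0 : 𝔼 n) 1, g t * bumpProfile (‖t - y‖ ^ 2 / s ^ 2)|
      ≤ ∫ t in ball (0 : 𝔼 n) 1, C * bumpProfile (‖t - y‖ ^ 2 / s ^ 2) := by
        rw [← Real.norm_eq_abs]
        refine norm_integral_le_of_norm_le (hintble.const_mul C).restrict (ae_restrict_of_ae ?_)
        filter_upwards [(ae_restrict_iff' measurableSet_ball).1 hg] with t ht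
        rw [norm_mul, Real.norm_of_nonneg (bumpProfile_nonneg _)]
        by_cases h : t ∈ ball y r
        · exact mul_le_mul_of_nonneg_right (ht h) (bumpProfile_nonneg _)
        · rw [mem_ball, dist_eq_norm, not_lt] at h
          rw [bumpProfile_of_one_le (one_le_sq_div_sq hs (hsr.trans h))]; simp
    _ ≤ ∫ t : 𝔼 n, C * bumpProfile (‖t - y‖ ^ 2 / s ^ 2) :=
        setIntegral_le_integral (hintble.const_mul C)
          (.of_forall fun t => mul_nonneg hC (bumpProfile_nonneg _))
    _ = _ := by rw [integral_const_mul, integral_radial_scale bumpProfile y hs, bumpMass]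

theorem tendsto_average {u : (𝔼 n) → ℝ} (hu : ContinuousOn u (ball 0 1)) {M : ℝ}
    (hM : ∀ x ∈ ball (0 : 𝔼 n) 1, |u x| ≤ M) {y : 𝔼 n} (hy : ‖y‖ < 1) :
    Tendsto (fun s => ∫ t in ball (0 : 𝔼 n) 1, u t * avgKernel n s (t - y)) (𝓝[>] 0)
      (𝓝 (kernelMass n * u y)) := by
  rw [Metric.tendsto_nhds]
  intro δ hδ
  have hm := kernelMass_pos n
  have hc : ContinuousAt u y := hu.continuousAt (isOpen_ball.mem_nhds (mem_ball_zero_iff.2 hy))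
  obtain ⟨ε, hε, hball⟩ := Metric.continuousAt_iff.1 hc (δ / (2 * kernelMass n)) (by positivity)
  have hmem : Ioo 0 (min ε (1 - ‖y‖)) ∈ 𝓝[>] (0 : ℝ) :=
    Ioo_mem_nhdsGT (lt_min hε (by linarith))
  filter_upwards [hmem] with s hs
  have hs0 : 0 < s := hs.1
  have hs1 : s < ε := hs.2.trans_le (min_le_left _ _)
  have hs2 : ‖y‖ + s ≤ 1 := by linarith [hs.2.trans_le (min_le_right _ _)]
  rw [dist_eq_norm, ← setIntegral_const_mul_avgKernel (u y) hs0 hs2,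
    ← integral_sub (integrable_mul_avgKernel hu hM hs0 y)
      ((integrable_avgKernel_sub hs0 y).const_mul (u y)).restrict]
  have hle : ‖∫ t in ball (0 : 𝔼 n) 1,
      (u t * avgKernel n s (t - y) - u y * avgKernel n s (t - y))‖ ≤
      ∫ t in ball (0 : 𝔼 n) 1, δ / (2 * kernelMass n) * avgKernel n s (t - y) := by
    refine norm_integral_le_of_norm_le
      ((integrable_avgKernel_sub hs0 y).const_mul _).restrict (.of_forall fun t => ?_)
    rw [← sub_mul, norm_mul, Real.norm_of_nonneg (avgKernel_nonneg hs0 _)]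
    by_cases h : dist t y < ε
    · exact mul_le_mul_of_nonneg_right (hball h).le (avgKernel_nonneg hs0 _)
    · rw [dist_eq_norm, not_lt] at h
      rw [avgKernel_of_le_norm hs0 (hs1.le.trans h)]; simp
  rw [setIntegral_const_mul_avgKernel _ hs0 hs2] at hle
  refine hle.trans_lt ?_
  have : kernelMass n * (δ / (2 * kernelMass n)) = δ / 2 := by field_simp
  linarith

/-- A continuous function whose distributional Laplacian is bounded by `C` differs from its
averages at scale `r` by at most a multiple of `C * r ^ 2`. -/
theorem abs_average_sub_le {u g : (𝔼 n) → ℝ} (hu : ContinuousOn u (ball 0 1)) {M : ℝ}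
    (hM : ∀ x ∈ ball (0 : 𝔼 n) 1, |u x| ≤ M) (hug : IsDistribLaplacian u g)
    {y : 𝔼 n} {r C : ℝ} (hr : 0 < r) (hy : ‖y‖ + r < 1)
    (hg : ∀ᵐ x ∂(volume.restrict (ball y r)), |g x| ≤ C) (hC : 0 ≤ C) :
    |(∫ t in ball (0 : 𝔼 n) 1, u t * avgKernel n r (t - y)) - kernelMass n * u y| ≤
      C * bumpMass n * r ^ 2 := by
  have hlim := (tendsto_average hu hM (y := y) (by linarith)).const_sub
    (∫ t in ball (0 : 𝔼 n) 1, u t * avgKernel n r (t - y)) |>.abs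
  have hb := bumpMass_nonneg n
  refine le_of_tendsto hlim ?_
  filter_upwards [Ioo_mem_nhdsGT hr] with ε hε
  have h := (convex_Icc ε r).norm_image_sub_le_of_norm_hasDerivWithin_le
    (f := fun s => ∫ t in ball (0 : 𝔼 n) 1, u t * avgKernel n s (t - y))
    (C := C * bumpMass n * r)
    (fun s hs => (hasDerivAt_average hu hM hug (hε.1.trans_le hs.1)
      (by linarith [hs.2])).hasDerivWithinAt) (fun s hs => ?_)
    (left_mem_Icc.2 hε.2.le) (right_mem_Icc.2 hε.2.le)
  · refine h.trans ?_
    rw [Real.norm_of_nonneg (by linarith [hε.2]), pow_two, ← mul_assoc]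
    exact mul_le_mul_of_nonneg_left (by linarith [hε.1]) (by positivity)
  · have hs0 : 0 < s := hε.1.trans_le hs.1
    rw [norm_mul, Real.norm_of_nonneg (by positivity)]
    calc _ ≤ s * (s ^ n)⁻¹ * (C * (s ^ n * bumpMass n)) :=
          mul_le_mul_of_nonneg_left (abs_integral_mul_bump_le hs0 hs.2 hg hC) (by positivity)
      _ = C * bumpMass n * s := by field_simp
      _ ≤ _ := mul_le_mul_of_nonneg_left hs.2 (by positivity)

theorem setIntegral_linear_mul_avgKernel (L : (𝔼 n) →L[ℝ] ℝ) {y : 𝔼 n} {s : ℝ} (hs : 0 < s)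
    (hy : ‖y‖ + s ≤ 1) : ∫ t in ball (0 : 𝔼 n) 1, L (t - y) * avgKernel n s (t - y) = 0 := by
  rw [setIntegral_mul_avgKernel (fun t => L (t - y)) hs hy,
    integral_sub_right_eq_self (fun t => L t * avgKernel n s t) y]
  have h := integral_neg_eq_self (fun t => L t * avgKernel n s t) volume
  have h2 : (fun t => L (-t) * avgKernel n s (-t)) = fun t => -(L t * avgKernel n s t) := by
    ext t; simp [avgKernel]
  rw [h2, integral_neg] at h
  linarith

theorem average_sub_affine {u : (𝔼 n) → ℝ} (hu : ContinuousOn u (ball 0 1)) {M : ℝ}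
    (hM : ∀ x ∈ ball (0 : 𝔼 n) 1, |u x| ≤ M) (a : ℝ) (L : (𝔼 n) →L[ℝ] ℝ) (x₀ : 𝔼 n)
    {y : 𝔼 n} {s : ℝ} (hs : 0 < s) (hy : ‖y‖ + s ≤ 1) :
    (∫ t in ball (0 : 𝔼 n) 1, (u t - (a + L (t - x₀))) * avgKernel n s (t - y)) -
        kernelMass n * (u y - (a + L (y - x₀))) =
      (∫ t in ball (0 : 𝔼 n) 1, u t * avgKernel n s (t - y)) - kernelMass n * u y := by
  have hintble : Integrable (fun t => L (t - y) * avgKernel n s (t - y))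
      (volume.restrict (ball (0 : 𝔼 n) 1)) :=
    (((L.continuous.comp (continuous_sub_right y)).mul
      (continuous_avgKernel_sub s y)).integrable_of_hasCompactSupport
        (hasCompactSupport_avgKernel_sub hs y).mul_left).restrict
  have h : ∀ t, (u t - (a + L (t - x₀))) * avgKernel n s (t - y) =
      u t * avgKernel n s (t - y) - ((a + L (y - x₀)) * avgKernel n s (t - y) +
        L (t - y) * avgKernel n s (t - y)) := by
    intro t; simp only [map_sub]; ring
  have hconst : Integrable (fun t => (a + L (y - x₀)) * avgKernel n s (t - y))
      (volume.restrict (ball (0 : 𝔼 n) 1)) := ((integrable_avgKernel_sub hs y).const_mul _).restrict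
  have hadd : Integrable (fun t => (a + L (y - x₀)) * avgKernel n s (t - y) +
      L (t - y) * avgKernel n s (t - y)) (volume.restrict (ball (0 : 𝔼 n) 1)) := hconst.add hintble
  simp only [h]
  rw [integral_sub (integrable_mul_avgKernel hu hM hs y) hadd,
    integral_add hconst hintble, setIntegral_const_mul_avgKernel _ hs hy,
    setIntegral_linear_mul_avgKernel L hs hy]
  ring

/-! ### Quadratic growth at contact points -/

theorem avgKernel_quarter_le {a A : ℝ} (ha : 0 < a)
    (hmin : ∀ t, 0 ≤ t → t ≤ 1 / 4 → a ≤ kernelProfile t)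
    (hmax : ∀ t, 0 ≤ t → kernelProfile t ≤ A) {R : ℝ} (hR : 0 < R) (w : 𝔼 n) {z : 𝔼 n}
    (hz : ‖z‖ ≤ R / 2) :
    avgKernel n (R / 4) w ≤ 4 ^ n * (A / a) * avgKernel n R z := by
  have h1 : a ≤ kernelProfile (‖z‖ ^ 2 / R ^ 2) := by
    refine hmin _ (by positivity) ?_
    rw [div_le_iff₀ (by positivity)]
    nlinarith [norm_nonneg z]
  have hA : 0 ≤ A := (kernelProfile_nonneg 0).trans (hmax 0 le_rfl)
  have h2 : kernelProfile (‖w‖ ^ 2 / (R / 4) ^ 2) ≤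
      A / a * kernelProfile (‖z‖ ^ 2 / R ^ 2) := by
    refine (hmax _ (by positivity)).trans ?_
    rw [div_mul_eq_mul_div, le_div_iff₀ ha]
    exact mul_le_mul_of_nonneg_left h1 hA
  unfold avgKernel
  calc ((R / 4) ^ n)⁻¹ * kernelProfile (‖w‖ ^ 2 / (R / 4) ^ 2)
      ≤ ((R / 4) ^ n)⁻¹ * (A / a * kernelProfile (‖z‖ ^ 2 / R ^ 2)) :=
        mul_le_mul_of_nonneg_left h2 (by positivity)
    _ = _ := by rw [div_pow, inv_div]; ring

/-- If `u` stays above a concave paraboloid touching it at `x₀` and its averages are almost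
its values, then it grows at most quadratically away from the tangent plane of the paraboloid. -/
theorem exists_quadratic_growth_of_touching (n : ℕ) {C K : ℝ} (hC : 0 ≤ C) (hK : 0 ≤ K) :
    ∃ A : ℝ, 0 ≤ A ∧ ∀ (u : (𝔼 n) → ℝ) (M : ℝ), ContinuousOn u (ball 0 1) →
      (∀ x ∈ ball (0 : 𝔼 n) 1, |u x| ≤ M) →
      (∀ (y : 𝔼 n) (r : ℝ), 0 < r → ‖y‖ + r < 1 →
        |(∫ t in ball (0 : 𝔼 n) 1, u t * avgKernel n r (t - y)) - kernelMass n * u y| ≤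
          C * r ^ 2) →
      ∀ (x₀ : 𝔼 n) (L : (𝔼 n) →L[ℝ] ℝ), ‖x₀‖ < 3 / 4 →
      (∀ x ∈ ball (0 : 𝔼 n) 1, u x₀ + L (x - x₀) - K * ‖x - x₀‖ ^ 2 ≤ u x) →
      ∀ x, ‖x - x₀‖ < 1 / 16 → |u x - u x₀ - L (x - x₀)| ≤ A * ‖x - x₀‖ ^ 2 := by
  obtain ⟨b, hb, hmax⟩ := exists_kernelProfile_le
  obtain ⟨a, ha, hmin⟩ := exists_le_kernelProfile
  have hm := kernelMass_pos n
  set Q : ℝ := 4 ^ n * (b / a)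
  have hQ : 0 < Q := by positivity
  set H : ℝ := (Q * (kernelMass n * K + C) + C) / kernelMass n with hH
  have hH0 : 0 ≤ H := by positivity
  refine ⟨16 * (H + K), by positivity, fun u M hu hM hmv x₀ L hx₀ htouch x hx => ?_⟩
  rcases eq_or_ne x x₀ with rfl | hne
  · simp
  have hρ : 0 < ‖x - x₀‖ := norm_pos_iff.2 (sub_ne_zero.2 hne)
  set R : ℝ := 4 * ‖x - x₀‖ with hRdef
  have hR : 0 < R := by positivity
  have hxn : ‖x‖ ≤ ‖x₀‖ + ‖x - x₀‖ := by linarith [norm_sub_norm_le x x₀]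
  set w : (𝔼 n) → ℝ := fun t => u t - (u x₀ - K * R ^ 2 + L (t - x₀)) with hw
  have hw0 : ∀ t ∈ ball (0 : 𝔼 n) 1, ‖t - x₀‖ ≤ R → 0 ≤ w t := by
    intro t ht htR
    have h1 := htouch t ht
    have h2 : K * ‖t - x₀‖ ^ 2 ≤ K * R ^ 2 := by gcongr
    simp only [hw]; linarith
  have hwc : ContinuousOn w (ball 0 1) :=
    hu.sub (by fun_prop)
  have hwM : ∀ t ∈ ball (0 : 𝔼 n) 1, |w t| ≤ M + (|u x₀ - K * R ^ 2| + ‖L‖ * 2) := by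
    intro t ht
    have h1 : |L (t - x₀)| ≤ ‖L‖ * 2 := by
      refine (L.le_opNorm _).trans (mul_le_mul_of_nonneg_left ?_ (norm_nonneg L))
      have := norm_sub_le t x₀
      rw [mem_ball_zero_iff] at ht
      linarith
    calc |w t| ≤ |u t| + |u x₀ - K * R ^ 2 + L (t - x₀)| := abs_sub _ _
      _ ≤ _ := by linarith [hM t ht, abs_add_le (u x₀ - K * R ^ 2) (L (t - x₀))]
  have hyR : ‖x₀‖ + R < 1 := by linarith
  have hxR : ‖x‖ + R / 4 < 1 := by linarith
  have h0 := hmv x₀ R hR hyR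
  have h1 := hmv x (R / 4) (by positivity) hxR
  rw [← average_sub_affine hu hM (u x₀ - K * R ^ 2) L x₀ hR hyR.le] at h0
  rw [← average_sub_affine hu hM (u x₀ - K * R ^ 2) L x₀ (by positivity) hxR.le] at h1
  have hcmp : ∫ t in ball (0 : 𝔼 n) 1, w t * avgKernel n (R / 4) (t - x) ≤
      ∫ t in ball (0 : 𝔼 n) 1, Q * (w t * avgKernel n R (t - x₀)) := by
    refine setIntegral_mono_on (integrable_mul_avgKernel hwc hwM (by positivity) x)
      ((integrable_mul_avgKernel hwc hwM hR x₀).const_mul Q) measurableSet_ball fun t ht => ?_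
    have htri : ‖t - x₀‖ ≤ ‖t - x‖ + ‖x - x₀‖ := norm_sub_le_norm_sub_add_norm_sub t x x₀
    rcases le_or_gt (R / 4) ‖t - x‖ with h | h
    · rw [avgKernel_of_le_norm (by positivity) h, mul_zero]
      rcases le_total R ‖t - x₀‖ with h' | h'
      · rw [avgKernel_of_le_norm hR h']; simp
      · exact mul_nonneg hQ.le (mul_nonneg (hw0 t ht h') (avgKernel_nonneg hR _))
    · have hz : ‖t - x₀‖ ≤ R / 2 := by linarith
      have h2 := avgKernel_quarter_le (n := n) ha hmin hmax hR (t - x) hz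
      calc w t * avgKernel n (R / 4) (t - x)
          ≤ w t * (Q * avgKernel n R (t - x₀)) :=
            mul_le_mul_of_nonneg_left h2 (hw0 t ht (by linarith))
        _ = _ := by ring
  rw [integral_const_mul] at hcmp
  have e0 := (abs_le.1 h0).2
  have e1 := (abs_le.1 h1).1
  rw [sub_self, map_zero] at e0
  change (∫ t in ball (0 : 𝔼 n) 1, w t * avgKernel n R (t - x₀)) - _ ≤ _ at e0
  change _ ≤ (∫ t in ball (0 : 𝔼 n) 1, w t * avgKernel n (R / 4) (t - x)) -
    kernelMass n * w x at e1
  set I₀ := ∫ t in ball (0 : 𝔼 n) 1, w t * avgKernel n R (t - x₀)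
  have e2 : I₀ ≤ (kernelMass n * K + C) * R ^ 2 := by linarith
  have e3 : Q * I₀ ≤ Q * ((kernelMass n * K + C) * R ^ 2) := mul_le_mul_of_nonneg_left e2 hQ.le
  have e4 : C * (R / 4) ^ 2 ≤ C * R ^ 2 := by gcongr; linarith
  have e5 : kernelMass n * w x ≤ kernelMass n * (H * R ^ 2) := by
    have : kernelMass n * (H * R ^ 2) = (Q * (kernelMass n * K + C) + C) * R ^ 2 := by
      rw [hH]; field_simp
    rw [this]; linarith
  have e6 : w x ≤ H * R ^ 2 := le_of_mul_le_mul_left e5 hm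
  have e7 : 0 ≤ w x := hw0 x (by rw [mem_ball_zero_iff]; linarith) (by linarith)
  have e8 : u x - u x₀ - L (x - x₀) = w x - K * R ^ 2 := by simp only [hw]; ring
  have e9 : 16 * (H + K) * ‖x - x₀‖ ^ 2 = H * R ^ 2 + K * R ^ 2 := by rw [hRdef]; ring
  have : 0 ≤ H * R ^ 2 := by positivity
  have : 0 ≤ K * R ^ 2 := by positivity
  rw [e8, e9, abs_le]
  constructor <;> linarith

/-! ### Interior estimate -/

theorem exists_taylor_avgKernel_one (n : ℕ) : ∃ Λ : ℝ, 0 ≤ Λ ∧ ∀ a h : 𝔼 n,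
    |avgKernel n 1 (a + h) - avgKernel n 1 a - fderiv ℝ (avgKernel n 1) a h| ≤ Λ * ‖h‖ ^ 2 := by
  have hc : HasCompactSupport (avgKernel n 1) := by
    simpa using hasCompactSupport_avgKernel_sub (n := n) one_pos 0
  have hd := contDiff_avgKernel (n := n) 1
  obtain ⟨Λ, hΛ⟩ := ContDiff.lipschitzWith_of_hasCompactSupport (𝕂 := ℝ) (n := 1)
    (hc.fderiv (𝕜 := ℝ)) (hd.fderiv_right (by norm_num; exact WithTop.coe_le_coe.2 le_top)) one_ne_zero
  refine ⟨Λ, Λ.2, fun a h => ?_⟩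
  have := (convex_closedBall a ‖h‖).norm_image_sub_le_of_norm_fderiv_le' (𝕜 := ℝ)
    (f := avgKernel n 1) (C := Λ * ‖h‖) (x := a) (y := a + h) (φ := fderiv ℝ (avgKernel n 1) a)
    (fun x _ => hd.differentiable (by simp) x)
    (fun x hx => by
      refine (hΛ.norm_sub_le x a).trans (mul_le_mul_of_nonneg_left ?_ Λ.2)
      rwa [← dist_eq_norm])
    (by simp) (by simp)
  simpa [pow_two, mul_assoc] using this

theorem avgKernel_eq_smul {s : ℝ} (hs : 0 < s) (z : 𝔼 n) :
    avgKernel n s z = (s ^ n)⁻¹ * avgKernel n 1 (s⁻¹ • z) := by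
  simp only [avgKernel, one_pow, inv_one, one_mul, norm_smul, norm_inv,
    Real.norm_of_nonneg hs.le, mul_pow, inv_pow, div_eq_inv_mul]

theorem continuous_fderiv_avgKernel_one : Continuous (fderiv ℝ (avgKernel n 1)) :=
  (contDiff_avgKernel 1).continuous_fderiv (by simp)

/-- A function equal to its averages has a second order Taylor estimate. -/
theorem exists_interior_estimate (n : ℕ) : ∃ B : ℝ, 0 ≤ B ∧
    ∀ (v : (𝔼 n) → ℝ) (y : 𝔼 n) (d A : ℝ), 0 < d → ‖y‖ + d < 1 →
      ContinuousOn v (ball 0 1) → (∀ x ∈ ball y d, |v x| ≤ A) →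
      (∀ x, ‖x - y‖ < d / 2 →
        ∫ t in ball (0 : 𝔼 n) 1, v t * avgKernel n (d / 2) (t - x) = kernelMass n * v x) →
      ∃ L : (𝔼 n) →L[ℝ] ℝ, ∀ x, ‖x - y‖ < d / 2 →
        |v x - v y - L (x - y)| ≤ B * (A / d ^ 2) * ‖x - y‖ ^ 2 := by
  obtain ⟨Λ, hΛ0, hΛ⟩ := exists_taylor_avgKernel_one n
  have hm := kernelMass_pos n
  set ω : ℝ := volume.real (ball (0 : 𝔼 n) 1) with hω
  have hω0 : 0 ≤ ω := measureReal_nonneg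
  refine ⟨4 * 2 ^ n * Λ * ω / kernelMass n, by positivity,
    fun v y d A hd hyd hv hA hmean => ?_⟩
  set s := d / 2 with hsdef
  have hs : 0 < s := by positivity
  have hsub : ball y d ⊆ ball (0 : 𝔼 n) 1 := by
    intro t ht
    rw [mem_ball, dist_eq_norm] at ht
    rw [mem_ball_zero_iff]
    linarith [norm_sub_norm_le t y]
  have hvm : AEStronglyMeasurable v (volume.restrict (ball y d)) :=
    (hv.mono hsub).aestronglyMeasurable measurableSet_ball
  have hvA : ∀ᵐ t ∂(volume.restrict (ball y d)), ‖v t‖ ≤ A :=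
    (ae_restrict_iff' measurableSet_ball).2 (.of_forall hA)
  have : IsFiniteMeasure (volume.restrict (ball y d)) := ⟨by simpa using measure_ball_lt_top⟩
  have hvi : Integrable v (volume.restrict (ball y d)) :=
    Integrable.of_bound hvm A hvA
  have hmean' : ∀ x, ‖x - y‖ < s →
      ∫ t in ball y d, v t * avgKernel n s (t - x) = kernelMass n * v x := by
    intro x hx
    rw [← hmean x hx]
    refine (setIntegral_eq_of_subset_of_forall_sdiff_eq_zero measurableSet_ball hsub
      fun t ht => ?_).symm
    have h2 := ht.2
    rw [mem_ball, dist_eq_norm, not_lt] at h2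
    rw [avgKernel_of_le_norm hs, mul_zero]
    linarith [norm_sub_le_norm_sub_add_norm_sub t x y]
  have hki : ∀ x, Integrable (fun t => v t * avgKernel n s (t - x))
      (volume.restrict (ball y d)) := fun x =>
    (integrable_avgKernel_sub hs x).restrict.bdd_mul (c := A) hvm hvA
  set D : (𝔼 n) → (𝔼 n) →L[ℝ] ℝ := fun t =>
    (-((s ^ n)⁻¹ * s⁻¹ * v t)) • fderiv ℝ (avgKernel n 1) (s⁻¹ • (t - y)) with hD
  have hDi : Integrable D (volume.restrict (ball y d)) := by
    obtain ⟨E, hE⟩ := (isCompact_closedBall y d).exists_bound_of_continuousOn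
      (f := fun t => fderiv ℝ (avgKernel n 1) (s⁻¹ • (t - y)))
      (continuous_fderiv_avgKernel_one.comp (by fun_prop)).continuousOn
    have hcont : Continuous fun t => fderiv ℝ (avgKernel n 1) (s⁻¹ • (t - y)) :=
      continuous_fderiv_avgKernel_one.comp (by fun_prop)
    exact (hvi.const_mul ((s ^ n)⁻¹ * s⁻¹)).neg.smul_bdd E hcont.aestronglyMeasurable
      ((ae_restrict_iff' measurableSet_ball).2
        (.of_forall fun t ht => hE t (ball_subset_closedBall ht)))
  refine ⟨(kernelMass n)⁻¹ • ∫ t in ball y d, D t, fun x hx => ?_⟩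
  have hDx : Integrable (fun t => D t (x - y)) (volume.restrict (ball y d)) :=
    hDi.apply_continuousLinearMap (x - y)
  have hrep : kernelMass n * (v x - v y - ((kernelMass n)⁻¹ • ∫ t in ball y d, D t) (x - y)) =
      ∫ t in ball y d, (v t * avgKernel n s (t - x) - v t * avgKernel n s (t - y) -
        D t (x - y)) := by
    have hsubi : Integrable (fun t => v t * avgKernel n s (t - x) - v t * avgKernel n s (t - y))
        (volume.restrict (ball y d)) := (hki x).sub (hki y)
    rw [integral_sub hsubi hDx, integral_sub (hki x) (hki y), hmean' x hx,
      hmean' y (by simpa using hs), smul_apply, ContinuousLinearMap.integral_apply hDi,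
      smul_eq_mul]
    field_simp
  have hvol : volume.real (ball y d) = d ^ n * ω := by
    rw [measureReal_def, Measure.addHaar_ball_of_pos _ _ hd, ENNReal.toReal_mul,
      ENNReal.toReal_ofReal (by positivity), finrank_euclideanSpace_fin, hω, measureReal_def]
  have hbound : |kernelMass n *
      (v x - v y - ((kernelMass n)⁻¹ • ∫ t in ball y d, D t) (x - y))| ≤
      A * ((s ^ n)⁻¹ * (Λ * (s⁻¹ * ‖x - y‖) ^ 2)) * (d ^ n * ω) := by
    rw [hrep, ← hvol, ← Real.norm_eq_abs]
    refine norm_setIntegral_le_of_norm_le_const measure_ball_lt_top fun t ht => ?_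
    have h1 := hΛ (s⁻¹ • (t - y)) (s⁻¹ • (y - x))
    rw [← smul_add, sub_add_sub_cancel, norm_smul, norm_inv, Real.norm_of_nonneg hs.le,
      norm_sub_rev y x] at h1
    have h2 : v t * avgKernel n s (t - x) - v t * avgKernel n s (t - y) - D t (x - y) =
        v t * ((s ^ n)⁻¹ * (avgKernel n 1 (s⁻¹ • (t - x)) - avgKernel n 1 (s⁻¹ • (t - y)) -
          fderiv ℝ (avgKernel n 1) (s⁻¹ • (t - y)) (s⁻¹ • (y - x)))) := by
      rw [avgKernel_eq_smul hs, avgKernel_eq_smul hs, hD, ← neg_sub x y]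
      simp only [smul_apply, smul_eq_mul, smul_neg, map_neg, map_smul]
      ring
    rw [h2, norm_mul, norm_mul, Real.norm_of_nonneg (show 0 ≤ (s ^ n)⁻¹ by positivity)]
    exact mul_le_mul (hA t ht) (mul_le_mul_of_nonneg_left h1 (by positivity)) (by positivity)
      ((abs_nonneg _).trans (hA t ht))
  rw [abs_mul, abs_of_pos hm, ← le_div_iff₀' hm] at hbound
  refine hbound.trans_eq ?_
  rw [hsdef, div_pow]
  field_simp
  ring

/-! ### Second order approximation -/

/-- A local second order estimate extends to the whole ball under a quadratic growth bound. -/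
theorem abs_sub_linear_le_of_local {v : (𝔼 n) → ℝ} {y : 𝔼 n} {d A A' : ℝ} (hd : 0 < d)
    (hyd : ‖y‖ + d < 1) (hA0 : 0 ≤ A) (hA0' : 0 ≤ A')
    (hA : ∀ x ∈ ball (0 : 𝔼 n) 1, |v x| ≤ A * (‖x - y‖ + d) ^ 2) (L : (𝔼 n) →L[ℝ] ℝ)
    (hA' : ∀ x, ‖x - y‖ < d / 2 → |v x - v y - L (x - y)| ≤ A' * ‖x - y‖ ^ 2)
    {x : 𝔼 n} (hx : x ∈ ball (0 : 𝔼 n) 1) :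
    |v x - v y - L (x - y)| ≤ (53 * A + 8 * A') * ‖x - y‖ ^ 2 := by
  rcases lt_or_ge ‖x - y‖ (d / 2) with h | h
  · refine (hA' x h).trans ?_
    gcongr
    linarith
  set ρ := ‖x - y‖ with hρdef
  have hρ : 0 < ρ := by linarith
  have hvy : |v y| ≤ A * d ^ 2 := by
    simpa using hA y (by rw [mem_ball_zero_iff]; linarith)
  set h' : 𝔼 n := (d / (4 * ρ)) • (x - y) with hh'
  have hn : ‖h'‖ = d / 4 := by
    rw [hh', norm_smul, Real.norm_of_nonneg (by positivity), ← hρdef]; field_simp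
  have hin : y + h' ∈ ball (0 : 𝔼 n) 1 := by
    rw [mem_ball_zero_iff]
    linarith [norm_add_le y h']
  have h1 := hA (y + h') hin
  have h2 := hA' (y + h') (by rw [add_sub_cancel_left, hn]; linarith)
  rw [add_sub_cancel_left, hn] at h1 h2
  have h3 : |L h'| ≤ (5 * A + A') * d ^ 2 := by
    have e1 : A * (d / 4 + d) ^ 2 ≤ 4 * A * d ^ 2 := by nlinarith [mul_nonneg hA0 (sq_nonneg d)]
    have e2 : A' * (d / 4) ^ 2 ≤ A' * d ^ 2 := by nlinarith [mul_nonneg hA0' (sq_nonneg d)]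
    have := abs_le.1 h1
    have := abs_le.1 h2
    have := abs_le.1 hvy
    rw [abs_le]
    constructor <;> linarith
  have h4 : |L h'| = d / (4 * ρ) * |L (x - y)| := by
    rw [hh', map_smul, smul_eq_mul, abs_mul, abs_of_nonneg (by positivity)]
  have hd2 : d ≤ 2 * ρ := by linarith
  have h5 : |L (x - y)| ≤ 8 * (5 * A + A') * ρ ^ 2 := by
    have e1 : |L (x - y)| = 4 * ρ / d * |L h'| := by rw [h4]; field_simp
    have e2 : 4 * ρ / d * |L h'| ≤ 4 * ρ / d * ((5 * A + A') * d ^ 2) :=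
      mul_le_mul_of_nonneg_left h3 (by positivity)
    have e3 : 4 * ρ / d * ((5 * A + A') * d ^ 2) = 4 * (5 * A + A') * ρ * d := by field_simp
    have e4 : 4 * (5 * A + A') * ρ * d ≤ 4 * (5 * A + A') * ρ * (2 * ρ) := by gcongr
    linarith
  have h6 : |v x| ≤ 9 * A * ρ ^ 2 := by
    refine (hA x hx).trans ?_
    have : A * (ρ + d) ^ 2 ≤ A * (ρ + 2 * ρ) ^ 2 := by gcongr
    linarith
  have h7 : |v y| ≤ 4 * A * ρ ^ 2 := by
    have : A * d ^ 2 ≤ A * (2 * ρ) ^ 2 := by gcongr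
    linarith
  have := abs_le.1 h5
  have := abs_le.1 h6
  have := abs_le.1 h7
  rw [abs_le]
  constructor <;> linarith

theorem hasFDerivAt_of_second_order {u : (𝔼 n) → ℝ} {C : ℝ} {y : 𝔼 n} (hy : ‖y‖ < 1)
    {L : (𝔼 n) →L[ℝ] ℝ}
    (hL : ∀ x ∈ ball (0 : 𝔼 n) 1, |u x - u y - L (x - y)| ≤ C * ‖x - y‖ ^ 2) :
    HasFDerivAt u L y := by
  refine .of_isLittleO (Asymptotics.IsBigO.trans_isLittleO (g := fun x => ‖x - y‖ ^ 2) ?_ ?_)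
  · refine .of_bound C ?_
    filter_upwards [isOpen_ball.mem_nhds (mem_ball_zero_iff.2 hy)] with x hx
    simpa using hL x hx
  · refine (Asymptotics.isLittleO_norm_pow_id one_lt_two).comp_tendsto (k := fun x => x - y) ?_
    exact tendsto_sub_nhds_zero_iff.2 tendsto_id

/-- Second order approximations by affine functions at two points have close linear parts. -/
theorem norm_sub_le_of_second_order {u : (𝔼 n) → ℝ} {C : ℝ} {y y' : 𝔼 n} (hne : y ≠ y')
    (hy : ‖y‖ < 1 / 2) (hy' : ‖y'‖ < 1 / 2) (hC : 0 ≤ C) {L L' : (𝔼 n) →L[ℝ] ℝ}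
    (hL : ∀ x ∈ ball (0 : 𝔼 n) 1, |u x - u y - L (x - y)| ≤ C * ‖x - y‖ ^ 2)
    (hL' : ∀ x ∈ ball (0 : 𝔼 n) 1, |u x - u y' - L' (x - y')| ≤ C * ‖x - y'‖ ^ 2) :
    ‖L - L'‖ ≤ 5 * C * ‖y - y'‖ := by
  refine ContinuousLinearMap.opNorm_le_bound _ (by positivity) fun e => ?_
  rcases eq_or_ne e 0 with rfl | he
  · simp
  have hd : 0 < ‖y - y'‖ := norm_pos_iff.2 (sub_ne_zero.2 hne)
  have hd1 : ‖y - y'‖ < 1 := by linarith [norm_sub_le y y']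
  have hen : 0 < ‖e‖ := norm_pos_iff.2 he
  set d := ‖y - y'‖ with hddef
  have hpt : ∀ h : 𝔼 n, ‖h‖ = d / 2 →
      |u (y + h) - u y - L h| ≤ C * (d / 2) ^ 2 ∧
      |u (y + h) - u y' - L' (y - y') - L' h| ≤ C * (3 * d / 2) ^ 2 := by
    intro h hh
    have hin : y + h ∈ ball (0 : 𝔼 n) 1 := by
      rw [mem_ball_zero_iff]; linarith [norm_add_le y h]
    have h1 := hL _ hin
    have h2 := hL' _ hin
    rw [add_sub_cancel_left, hh] at h1
    have h3 : y + h - y' = (y - y') + h := by abel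
    have h4 : ‖y + h - y'‖ ≤ 3 * d / 2 := by
      rw [h3]; linarith [norm_add_le (y - y') h]
    refine ⟨h1, ?_⟩
    calc _ = |u (y + h) - u y' - L' (y + h - y')| := by rw [h3, map_add, sub_sub, sub_sub]
      _ ≤ C * ‖y + h - y'‖ ^ 2 := h2
      _ ≤ _ := by gcongr
  set h : 𝔼 n := (d / (2 * ‖e‖)) • e with hh
  have hhn : ‖h‖ = d / 2 := by
    rw [hh, norm_smul, Real.norm_of_nonneg (by positivity)]; field_simp
  obtain ⟨a1, a2⟩ := hpt h hhn
  obtain ⟨b1, b2⟩ := hpt (-h) (by rwa [norm_neg])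
  rw [map_neg] at b1 b2
  have hq : |(L - L') h| ≤ 5 / 2 * C * d ^ 2 := by
    rw [sub_apply]
    have := abs_le.1 a1
    have := abs_le.1 a2
    have := abs_le.1 b1
    have := abs_le.1 b2
    rw [abs_le]
    constructor <;> linarith
  have hqe : |(L - L') e| = 2 * ‖e‖ / d * |(L - L') h| := by
    rw [hh, map_smul, smul_eq_mul, abs_mul, abs_of_nonneg (show 0 ≤ d / (2 * ‖e‖) by positivity)]
    field_simp
  rw [Real.norm_eq_abs, hqe]
  calc 2 * ‖e‖ / d * |(L - L') h| ≤ 2 * ‖e‖ / d * (5 / 2 * C * d ^ 2) :=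
        mul_le_mul_of_nonneg_left hq (by positivity)
    _ = _ := by field_simp

/-! ### The obstacles -/

theorem norm_fderiv_sub_eq_gradient (ψ : (𝔼 n) → ℝ) (x y : 𝔼 n) :
    ‖fderiv ℝ ψ x - fderiv ℝ ψ y‖ = ‖gradient ψ x - gradient ψ y‖ := by
  rw [gradient, gradient, ← map_sub, LinearIsometryEquiv.norm_map]

theorem abs_sub_fderiv_le_of_lipschitz_gradient {ψ : (𝔼 n) → ℝ} {K : NNReal}
    (hd : ∀ x ∈ ball (0 : 𝔼 n) 1, DifferentiableAt ℝ ψ x)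
    (hK : LipschitzOnWith K (gradient ψ) (ball 0 1)) {x y : 𝔼 n}
    (hx : x ∈ ball (0 : 𝔼 n) 1) (hy : y ∈ ball (0 : 𝔼 n) 1) :
    |ψ x - ψ y - fderiv ℝ ψ y (x - y)| ≤ K * ‖x - y‖ ^ 2 := by
  have hsub := (convex_ball (0 : 𝔼 n) 1).segment_subset hy hx
  have := (convex_segment (𝕜 := ℝ) y x).norm_image_sub_le_of_norm_fderiv_le' (𝕜 := ℝ)
    (f := ψ) (C := K * ‖x - y‖) (x := y) (y := x) (φ := fderiv ℝ ψ y)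
    (fun z hz => hd z (hsub hz))
    (fun z hz => by
      rw [norm_fderiv_sub_eq_gradient]
      refine (hK.norm_sub_le (hsub hz) hy).trans (mul_le_mul_of_nonneg_left ?_ K.2)
      obtain ⟨a, b, ha, hb, hab, rfl⟩ := hz
      have : a • y + b • x - y = b • (x - y) := by
        rw [← eq_sub_iff_add_eq] at hab; subst hab; module
      rw [this, norm_smul, Real.norm_of_nonneg hb]
      exact mul_le_of_le_one_left (norm_nonneg _) (by linarith))
    (left_mem_segment ℝ y x) (right_mem_segment ℝ y x)
  rw [← Real.norm_eq_abs, pow_two, ← mul_assoc]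
  exact this

theorem exists_abs_le_of_lipschitz_gradient {ψ : (𝔼 n) → ℝ} {K : NNReal}
    (hd : ∀ x ∈ ball (0 : 𝔼 n) 1, DifferentiableAt ℝ ψ x)
    (hK : LipschitzOnWith K (gradient ψ) (ball 0 1)) :
    ∃ B, ∀ x ∈ ball (0 : 𝔼 n) 1, |ψ x| ≤ B := by
  refine ⟨|ψ 0| + ‖fderiv ℝ ψ 0‖ + K, fun x hx => ?_⟩
  have h := abs_sub_fderiv_le_of_lipschitz_gradient hd hK hx (mem_ball_self one_pos)
  have hx1 : ‖x‖ ≤ 1 := (mem_ball_zero_iff.1 hx).le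
  have h1 : |fderiv ℝ ψ 0 x| ≤ ‖fderiv ℝ ψ 0‖ :=
    ((fderiv ℝ ψ 0).le_opNorm x).trans (mul_le_of_le_one_right (norm_nonneg _) hx1)
  have h2 : (K : ℝ) * ‖x‖ ^ 2 ≤ K :=
    mul_le_of_le_one_right K.2 (pow_le_one₀ (norm_nonneg _) hx1)
  rw [sub_zero] at h
  have := abs_le.1 h
  have := abs_le.1 h1
  have := neg_abs_le (ψ 0)
  have := le_abs_self (ψ 0)
  rw [abs_le]
  constructor <;> linarith

theorem abs_le_iSup_ball {u : (𝔼 n) → ℝ} {B : ℝ} (hB : ∀ x ∈ ball (0 : 𝔼 n) 1, |u x| ≤ B)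
    {x : 𝔼 n} (hx : x ∈ ball (0 : 𝔼 n) 1) : |u x| ≤ ⨆ x ∈ ball (0 : 𝔼 n) 1, |u x| := by
  have hbdd : BddAbove (range fun x => ⨆ _ : x ∈ ball (0 : 𝔼 n) 1, |u x|) := by
    refine ⟨B, ?_⟩
    rintro _ ⟨z, rfl⟩
    exact Real.iSup_le (fun hz => hB z hz) ((abs_nonneg _).trans (hB x hx))
  refine le_trans ?_ (le_ciSup hbdd x)
  rw [ciSup_pos hx]

/-- The solution has a uniform second order affine approximation at every point of `B_{1/2}`. -/
theorem exists_second_order_const (n : ℕ) (C₀ : ℝ) (K₀ : NNReal) {M : ℝ} (hM0 : 0 ≤ M) :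
    ∃ C : ℝ, 0 ≤ C ∧ ∀ ψ₁ ψ₂ u g : (𝔼 n) → ℝ,
      (∀ x ∈ ball (0 : 𝔼 n) 1, DifferentiableAt ℝ ψ₁ x) →
      LipschitzOnWith K₀ (gradient ψ₁) (ball 0 1) →
      (∀ x ∈ ball (0 : 𝔼 n) 1, DifferentiableAt ℝ ψ₂ x) →
      LipschitzOnWith K₀ (gradient ψ₂) (ball 0 1) →
      ContinuousOn u (ball 0 1) →
      (∀ x ∈ ball (0 : 𝔼 n) 1, ψ₁ x ≤ u x ∧ u x ≤ ψ₂ x) →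
      (∀ᵐ x ∂(volume.restrict (ball (0 : 𝔼 n) 1)), |g x| ≤ C₀) →
      (∀ᵐ x ∂(volume.restrict {x ∈ ball (0 : 𝔼 n) 1 | ψ₁ x < u x ∧ u x < ψ₂ x}), g x = 0) →
      IsDistribLaplacian u g →
      (∀ x ∈ ball (0 : 𝔼 n) 1, |u x| ≤ M) →
      ∀ y : 𝔼 n, ‖y‖ < 1 / 2 → ∃ L : (𝔼 n) →L[ℝ] ℝ, ∀ x ∈ ball (0 : 𝔼 n) 1,
        |u x - u y - L (x - y)| ≤ C * ‖x - y‖ ^ 2 := by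
  have hZ := bumpMass_nonneg n
  obtain ⟨G, hG0, hG⟩ := exists_quadratic_growth_of_touching n
    (C := |C₀| * bumpMass n) (K := K₀) (by positivity) K₀.2
  obtain ⟨B, hB0, hB⟩ := exists_interior_estimate n
  set A : ℝ := 53 * (64 * M) + 8 * G with hAdef
  have hA0 : 0 ≤ A := by positivity
  refine ⟨A + (53 * (4 * A) + 8 * (B * (16 * A))) + (53 * (64 * M) + 8 * (B * (64 * M))),
    by positivity, ?_⟩
  intro ψ₁ ψ₂ u g hd₁ hK₁ hd₂ hK₂ hu hψ hg hg0 hug hM y hy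
  have hgrow : ∀ y x : 𝔼 n, x ∈ ball (0 : 𝔼 n) 1 → |u x| ≤ 64 * M * (‖x - y‖ + 1 / 8) ^ 2 := by
    intro y x hx
    refine (hM x hx).trans ?_
    have : (1 : ℝ) / 64 ≤ (‖x - y‖ + 1 / 8) ^ 2 := by nlinarith [norm_nonneg (x - y)]
    nlinarith
  have hmv : ∀ (y : 𝔼 n) (r : ℝ), 0 < r → ‖y‖ + r < 1 →
      |(∫ t in ball (0 : 𝔼 n) 1, u t * avgKernel n r (t - y)) - kernelMass n * u y| ≤
        |C₀| * bumpMass n * r ^ 2 := by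
    intro y r hr hyr
    refine abs_average_sub_le hu hM hug hr hyr ?_ (abs_nonneg _)
    have hsub : ball y r ⊆ ball (0 : 𝔼 n) 1 :=
      ball_subset_ball' (by rw [dist_zero_right]; linarith)
    filter_upwards [ae_restrict_of_ae_restrict_of_subset hsub hg] with x hx
    exact hx.trans (le_abs_self _)
  have hcontact : ∀ x₀ : 𝔼 n, ‖x₀‖ < 3 / 4 → (u x₀ = ψ₁ x₀ ∨ u x₀ = ψ₂ x₀) →
      ∃ L : (𝔼 n) →L[ℝ] ℝ, ∀ x ∈ ball (0 : 𝔼 n) 1,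
        |u x - u x₀ - L (x - x₀)| ≤ A * ‖x - x₀‖ ^ 2 := by
    intro x₀ hx₀ hc
    have hx₀' : x₀ ∈ ball (0 : 𝔼 n) 1 := by rw [mem_ball_zero_iff]; linarith
    suffices ∃ L : (𝔼 n) →L[ℝ] ℝ, ∀ x, ‖x - x₀‖ < 1 / 16 →
        |u x - u x₀ - L (x - x₀)| ≤ G * ‖x - x₀‖ ^ 2 by
      obtain ⟨L, hL⟩ := this
      exact ⟨L, fun x hx => abs_sub_linear_le_of_local (d := 1 / 8) (by norm_num) (by linarith)
        (by positivity) hG0 (hgrow x₀) L (fun x hx => hL x (by linarith)) hx⟩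
    rcases hc with hc | hc
    · refine ⟨fderiv ℝ ψ₁ x₀, hG u M hu hM hmv x₀ _ hx₀ fun x hx => ?_⟩
      have := abs_le.1 (abs_sub_fderiv_le_of_lipschitz_gradient hd₁ hK₁ hx hx₀')
      linarith [(hψ x hx).1]
    · refine ⟨fderiv ℝ ψ₂ x₀, fun x hx => ?_⟩
      have h := hG (fun x => -u x) M hu.neg (by simpa using hM) (fun y r hr hyr => ?_) x₀
        (-fderiv ℝ ψ₂ x₀) hx₀ (fun x hx => ?_) x hx
      · rw [← abs_neg]
        convert h using 2
        simp only [neg_apply]; ring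
      · rw [← abs_neg]
        convert hmv y r hr hyr using 2
        simp only [neg_mul, integral_neg]; ring
      · have := abs_le.1 (abs_sub_fderiv_le_of_lipschitz_gradient hd₂ hK₂ hx hx₀')
        simp only [neg_apply]
        linarith [(hψ x hx).2]
  set F : Set (𝔼 n) := {x ∈ ball (0 : 𝔼 n) 1 | u x = ψ₁ x ∨ u x = ψ₂ x} with hF
  have hweaken : ∀ {C' : ℝ}, C' ≤ A + (53 * (4 * A) + 8 * (B * (16 * A))) +
      (53 * (64 * M) + 8 * (B * (64 * M))) → ∀ {L : (𝔼 n) →L[ℝ] ℝ},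
      (∀ x ∈ ball (0 : 𝔼 n) 1, |u x - u y - L (x - y)| ≤ C' * ‖x - y‖ ^ 2) →
      ∃ L : (𝔼 n) →L[ℝ] ℝ, ∀ x ∈ ball (0 : 𝔼 n) 1, |u x - u y - L (x - y)| ≤
        (A + (53 * (4 * A) + 8 * (B * (16 * A))) + (53 * (64 * M) + 8 * (B * (64 * M)))) *
          ‖x - y‖ ^ 2 := by
    intro C' hle L h
    exact ⟨L, fun x hx => (h x hx).trans (mul_le_mul_of_nonneg_right hle (by positivity))⟩
  have p1 : 0 ≤ 53 * (4 * A) + 8 * (B * (16 * A)) := by positivity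
  have p2 : 0 ≤ 53 * (64 * M) + 8 * (B * (64 * M)) := by positivity
  have hyball : y ∈ ball (0 : 𝔼 n) 1 := by rw [mem_ball_zero_iff]; linarith
  -- away from the contact set `u` agrees with its averages
  have hharm : ∀ d, 0 < d → ‖y‖ + d < 1 → Disjoint (ball y d) F → ∀ x, ‖x - y‖ < d / 2 →
      (∫ t in ball (0 : 𝔼 n) 1, u t * avgKernel n (d / 2) (t - x)) - kernelMass n * u x = 0 := by
    intro d hd hyd hdisj x hx
    have hball : ball y d ⊆ ball (0 : 𝔼 n) 1 :=
      ball_subset_ball' (by rw [dist_zero_right]; linarith)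
    have hsub : ball x (d / 2) ⊆ {x ∈ ball (0 : 𝔼 n) 1 | ψ₁ x < u x ∧ u x < ψ₂ x} := by
      intro t ht
      have hty : t ∈ ball y d := by
        rw [mem_ball, dist_eq_norm] at ht ⊢
        linarith [norm_sub_le_norm_sub_add_norm_sub t x y]
      have ht1 := hball hty
      have hnot : ¬ (u t = ψ₁ t ∨ u t = ψ₂ t) := fun h =>
        Set.disjoint_left.1 hdisj hty ⟨ht1, h⟩
      rw [not_or] at hnot
      exact ⟨ht1, lt_of_le_of_ne (hψ t ht1).1 (Ne.symm hnot.1),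
        lt_of_le_of_ne (hψ t ht1).2 hnot.2⟩
    have h := abs_average_sub_le hu hM hug (y := x) (r := d / 2) (C := 0) (by positivity)
      (by linarith [norm_sub_norm_le x y])
      (by
        filter_upwards [ae_restrict_of_ae_restrict_of_subset hsub hg0] with t ht
        simp [ht]) le_rfl
    rw [zero_mul, zero_mul] at h
    exact abs_nonpos_iff.1 h
  by_cases hyF : y ∈ F
  · obtain ⟨L, hL⟩ := hcontact y (by linarith) hyF.2
    exact hweaken (by linarith) hL
  by_cases hnear : Disjoint (ball y (1 / 8)) F
  · have hyd : ‖y‖ + 1 / 8 < 1 := by linarith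
    obtain ⟨L, hL⟩ := hB u y (1 / 8) M (by norm_num) hyd hu
      (fun x hx => hM x (ball_subset_ball' (by rw [dist_zero_right]; linarith) hx))
      (fun x hx => sub_eq_zero.1 (hharm _ (by norm_num) hyd hnear x hx))
    refine hweaken (C' := 53 * (64 * M) + 8 * (B * (64 * M))) (by linarith) fun x hx =>
      abs_sub_linear_le_of_local (d := 1 / 8) (by norm_num) hyd (by positivity) (by positivity)
        (hgrow y) L (fun x hx => (hL x hx).trans_eq ?_) hx
    ring
  · obtain ⟨z, hz1, hz2⟩ := Set.not_disjoint_iff.1 hnear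
    have hFne : F.Nonempty := ⟨z, hz2⟩
    set d := infDist y F with hd
    have hd8 : d < 1 / 8 := (infDist_le_dist_of_mem hz2).trans_lt (by rwa [dist_comm])
    have hd0 : 0 < d := by
      have hca : ∀ {f : (𝔼 n) → ℝ}, (∀ x ∈ ball (0 : 𝔼 n) 1, DifferentiableAt ℝ f x) →
          u y ≠ f y → ∀ᶠ x in 𝓝 y, u x ≠ f x := fun hf hne =>
        (((hu.continuousAt (isOpen_ball.mem_nhds hyball)).sub
          (hf y hyball).continuousAt).eventually_ne (sub_ne_zero.2 hne)).mono
            fun x hx => sub_ne_zero.1 hx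
      have hy12 : u y ≠ ψ₁ y ∧ u y ≠ ψ₂ y := by
        rw [← not_or]; exact fun h => hyF ⟨hyball, h⟩
      obtain ⟨ε, hε, hball⟩ := Metric.eventually_nhds_iff_ball.1
        ((hca hd₁ hy12.1).and (hca hd₂ hy12.2))
      refine hε.trans_le ((le_infDist hFne).2 fun x hx => ?_)
      by_contra hlt
      have := hball x (by rw [mem_ball, dist_comm]; linarith)
      exact hx.2.elim this.1 this.2
    have hyd : ‖y‖ + d < 1 := by linarith
    have hdisj : Disjoint (ball y d) F := disjoint_ball_infDist
    obtain ⟨x₀, hx₀F, hx₀d⟩ := (infDist_lt_iff hFne).1 (show infDist y F < 2 * d by linarith)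
    rw [dist_eq_norm] at hx₀d
    have hx₀n : ‖x₀‖ < 3 / 4 := by
      have := norm_sub_norm_le x₀ y
      rw [norm_sub_rev] at this
      linarith
    obtain ⟨L₀, hL₀⟩ := hcontact x₀ hx₀n hx₀F.2
    set v : (𝔼 n) → ℝ := fun x => u x - (u x₀ + L₀ (x - x₀)) with hv
    have hvgrow : ∀ x ∈ ball (0 : 𝔼 n) 1, |v x| ≤ 4 * A * (‖x - y‖ + d) ^ 2 := by
      intro x hx
      have h1 := hL₀ x hx
      rw [sub_sub] at h1
      have h2 : ‖x - x₀‖ ≤ 2 * (‖x - y‖ + d) := by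
        linarith [norm_sub_le_norm_sub_add_norm_sub x y x₀, norm_nonneg (x - y)]
      calc |v x| ≤ A * ‖x - x₀‖ ^ 2 := h1
        _ ≤ A * (2 * (‖x - y‖ + d)) ^ 2 := by gcongr
        _ = _ := by ring
    obtain ⟨L, hL⟩ := hB v y d (16 * A * d ^ 2) hd0 hyd (hu.sub (by fun_prop))
      (fun x hx => by
        have hx1 : x ∈ ball (0 : 𝔼 n) 1 :=
          ball_subset_ball' (by rw [dist_zero_right]; linarith) hx
        rw [mem_ball, dist_eq_norm] at hx
        calc |v x| ≤ 4 * A * (‖x - y‖ + d) ^ 2 := hvgrow x hx1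
          _ ≤ 4 * A * (d + d) ^ 2 := by gcongr
          _ = _ := by ring)
      (fun x hx => by
        have h := average_sub_affine hu hM (u x₀) L₀ x₀ (y := x) (s := d / 2) (by positivity)
          (by linarith [norm_sub_norm_le x y])
        rw [hharm d hd0 hyd hdisj x hx] at h
        exact sub_eq_zero.1 h)
    refine hweaken (C' := 53 * (4 * A) + 8 * (B * (16 * A))) (L := L₀ + L) (by linarith)
      fun x hx => ?_
    have h := abs_sub_linear_le_of_local hd0 hyd (A := 4 * A) (A' := B * (16 * A)) (by positivity)
      (by positivity) hvgrow L (fun x hx => (hL x hx).trans_eq (by field_simp)) hx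
    convert h using 2
    simp only [hv, add_apply, map_sub]; ring

/-- unconstrained double obstacle problem, Laplacian case of Theorem 2.1.
If `ψ₁ ≤ u ≤ ψ₂` with `ψ₁, ψ₂` of class `C^{1,1}` on `B₁` (Lipschitz constant of the
gradients at most `K₀`), `u` is continuous, and the distributional Laplacian of `u` is
represented by a function `g` with `|g| ≤ C₀` a.e. which vanishes a.e. on the open set
`{ψ₁ < u < ψ₂}`, then `u ∈ C^{1,1}(B_{1/2})`, with a Lipschitz bound on `∇u` depending
only on `n`, `C₀`, `K₀` and `sup_{B₁} |u|`. -/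
theorem unconstrained_double_obstacle_C11 :
    ∃ C : ℕ → ℝ → NNReal → ℝ → NNReal,
      ∀ (n : ℕ), 1 ≤ n →
      ∀ (ψ₁ ψ₂ u g : EuclideanSpace ℝ (Fin n) → ℝ) (C₀ : ℝ) (K₀ : NNReal),
      (∀ x ∈ ball (0 : EuclideanSpace ℝ (Fin n)) 1, DifferentiableAt ℝ ψ₁ x) →
      LipschitzOnWith K₀ (gradient ψ₁) (ball 0 1) →
      (∀ x ∈ ball (0 : EuclideanSpace ℝ (Fin n)) 1, DifferentiableAt ℝ ψ₂ x) →
      LipschitzOnWith K₀ (gradient ψ₂) (ball 0 1) →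
      (∀ x ∈ ball (0 : EuclideanSpace ℝ (Fin n)) 1, ψ₁ x ≤ ψ₂ x) →
      ContinuousOn u (ball 0 1) →
      (∀ x ∈ ball (0 : EuclideanSpace ℝ (Fin n)) 1, ψ₁ x ≤ u x ∧ u x ≤ ψ₂ x) →
      Measurable g →
      (∀ᵐ x ∂(volume.restrict (ball (0 : EuclideanSpace ℝ (Fin n)) 1)), |g x| ≤ C₀) →
      (∀ᵐ x ∂(volume.restrict
          {x ∈ ball (0 : EuclideanSpace ℝ (Fin n)) 1 | ψ₁ x < u x ∧ u x < ψ₂ x}),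
        g x = 0) →
      IsDistribLaplacian u g →
      (∀ x ∈ ball (0 : EuclideanSpace ℝ (Fin n)) (1/2), DifferentiableAt ℝ u x) ∧
      LipschitzOnWith
        (C n C₀ K₀ (⨆ x ∈ ball (0 : EuclideanSpace ℝ (Fin n)) 1, |u x|))
        (gradient u) (ball 0 (1/2)) := by
  have key : ∀ (n : ℕ) (C₀ : ℝ) (K₀ : NNReal) (M : ℝ), ∃ C : NNReal, 0 ≤ M →
      ∀ ψ₁ ψ₂ u g : EuclideanSpace ℝ (Fin n) → ℝ,
      (∀ x ∈ ball (0 : EuclideanSpace ℝ (Fin n)) 1, DifferentiableAt ℝ ψ₁ x) →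
      LipschitzOnWith K₀ (gradient ψ₁) (ball 0 1) →
      (∀ x ∈ ball (0 : EuclideanSpace ℝ (Fin n)) 1, DifferentiableAt ℝ ψ₂ x) →
      LipschitzOnWith K₀ (gradient ψ₂) (ball 0 1) →
      ContinuousOn u (ball 0 1) →
      (∀ x ∈ ball (0 : EuclideanSpace ℝ (Fin n)) 1, ψ₁ x ≤ u x ∧ u x ≤ ψ₂ x) →
      (∀ᵐ x ∂(volume.restrict (ball (0 : EuclideanSpace ℝ (Fin n)) 1)), |g x| ≤ C₀) →
      (∀ᵐ x ∂(volume.restrict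
          {x ∈ ball (0 : EuclideanSpace ℝ (Fin n)) 1 | ψ₁ x < u x ∧ u x < ψ₂ x}), g x = 0) →
      IsDistribLaplacian u g →
      (∀ x ∈ ball (0 : EuclideanSpace ℝ (Fin n)) 1, |u x| ≤ M) →
      (∀ x ∈ ball (0 : EuclideanSpace ℝ (Fin n)) (1/2), DifferentiableAt ℝ u x) ∧
        LipschitzOnWith C (gradient u) (ball 0 (1/2)) := by
    intro n C₀ K₀ M
    by_cases hM0 : 0 ≤ M
    swap
    · exact ⟨0, fun h => absurd h hM0⟩
    obtain ⟨C, hC0, hC⟩ := exists_second_order_const n C₀ K₀ hM0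
    refine ⟨(5 * C).toNNReal, fun _ ψ₁ ψ₂ u g hd₁ hK₁ hd₂ hK₂ hu hψ hg hg0 hug hM => ?_⟩
    choose! L hL using hC ψ₁ ψ₂ u g hd₁ hK₁ hd₂ hK₂ hu hψ hg hg0 hug hM
    have hder : ∀ y : EuclideanSpace ℝ (Fin n), ‖y‖ < 1 / 2 → HasFDerivAt u (L y) y :=
      fun y hy => hasFDerivAt_of_second_order (by linarith) (hL y hy)
    refine ⟨fun x hx => (hder x (mem_ball_zero_iff.1 hx)).differentiableAt,
      LipschitzOnWith.of_dist_le_mul fun x hx y hy => ?_⟩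
    rw [mem_ball_zero_iff] at hx hy
    rcases eq_or_ne x y with rfl | hne
    · simp
    rw [dist_eq_norm, dist_eq_norm, ← norm_fderiv_sub_eq_gradient, (hder x hx).fderiv,
      (hder y hy).fderiv, Real.coe_toNNReal _ (by positivity)]
    exact norm_sub_le_of_second_order hne hx hy hC0 (hL x hx) (hL y hy)
  choose C hC using key
  refine ⟨C, fun n _ ψ₁ ψ₂ u g C₀ K₀ hd₁ hK₁ hd₂ hK₂ _ hu hψ _ hg hg0 hug => ?_⟩
  obtain ⟨B₁, hB₁⟩ := exists_abs_le_of_lipschitz_gradient hd₁ hK₁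
  obtain ⟨B₂, hB₂⟩ := exists_abs_le_of_lipschitz_gradient hd₂ hK₂
  have hbdd : ∀ x ∈ ball (0 : EuclideanSpace ℝ (Fin n)) 1, |u x| ≤ max B₁ B₂ := fun x hx =>
    (abs_le_max_abs_abs (hψ x hx).1 (hψ x hx).2).trans (max_le_max (hB₁ x hx) (hB₂ x hx))
  have hsup : ∀ x ∈ ball (0 : EuclideanSpace ℝ (Fin n)) 1,
      |u x| ≤ ⨆ x ∈ ball (0 : EuclideanSpace ℝ (Fin n)) 1, |u x| :=
    fun x hx => abs_le_iSup_ball hbdd hx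
  exact hC n C₀ K₀ _ ((abs_nonneg _).trans (hsup 0 (mem_ball_self one_pos))) ψ₁ ψ₂ u g hd₁ hK₁
    hd₂ hK₂ hu hψ hg hg0 hug hsup
end
end

section
/- Let n ≥ 1, α ∈ (0,1) and M ≥ 0. Let u : B₁ → ℝ be continuous and bounded, and let f : B₁ → ℝ be measurable with |f(x)| ≤ M|x|^α for almost every x ∈ B₁, such that f represents the distributional Laplacian of u on B₁. Then u is C^{2,α} at the origin in the pointwise sense: there exist a polynomial P of degree at most 2 and a constant C depending only on n and α such that |u(x) − P(x)| ≤ C (M + sup_{B₁}|u|) |x|^{2+α} for all x ∈ B_{1/2}. -/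
open MeasureTheory Metric Set

noncomputable section

/-- The Laplacian of a radial function `y ↦ F (‖y - x‖²)`. -/
theorem lapl_comp_norm_sub_sq {n : ℕ} {F : ℝ → ℝ} (hF : ContDiff ℝ (⊤ : ℕ∞) F)
    (x y : EuclideanSpace ℝ (Fin n)) :
    lapl (fun y => F (‖y - x‖ ^ 2)) y =
      4 * ‖y - x‖ ^ 2 * deriv (deriv F) (‖y - x‖ ^ 2) + 2 * n * deriv F (‖y - x‖ ^ 2) := by
  have hF' : ContDiff ℝ (⊤ : ℕ∞) (deriv F) := (contDiff_infty_iff_deriv.1 hF).2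
  have hsq : ∀ z : EuclideanSpace ℝ (Fin n),
      HasFDerivAt (fun y => ‖y - x‖ ^ 2) (2 • innerSL ℝ (z - x)) z := fun z => by
    simpa using ((hasFDerivAt_id z).sub_const x).norm_sq
  have hcomp : ∀ {H : ℝ → ℝ}, ContDiff ℝ (⊤ : ℕ∞) H → ∀ z : EuclideanSpace ℝ (Fin n),
      HasFDerivAt (fun y => H (‖y - x‖ ^ 2))
        (deriv H (‖z - x‖ ^ 2) • (2 • innerSL ℝ (z - x))) z := fun {H} hH z =>
    ((hH.differentiable (by simp)) _).hasDerivAt.comp_hasFDerivAt z (hsq z)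
  have hcoord : ∀ i : Fin n,
      fderiv ℝ (fun y => fderiv ℝ (fun y => F (‖y - x‖ ^ 2)) y (EuclideanSpace.single i (1 : ℝ))) y
        (EuclideanSpace.single i (1 : ℝ)) =
      4 * (deriv (deriv F) (‖y - x‖ ^ 2) * (y - x) i ^ 2) + 2 * deriv F (‖y - x‖ ^ 2) := by
    intro i
    have h1 : (fun y => fderiv ℝ (fun y => F (‖y - x‖ ^ 2)) y (EuclideanSpace.single i (1 : ℝ)))
        = fun y => deriv F (‖y - x‖ ^ 2) * (2 * (y - x) i) := by
      funext z
      rw [(hcomp hF z).fderiv]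
      simp [EuclideanSpace.inner_single_right]
    have hc : HasFDerivAt (fun y : EuclideanSpace ℝ (Fin n) => 2 * (y - x) i)
        ((2 : ℝ) • (EuclideanSpace.proj i : EuclideanSpace ℝ (Fin n) →L[ℝ] ℝ)) y := by
      have := (((EuclideanSpace.proj i : EuclideanSpace ℝ (Fin n) →L[ℝ] ℝ).hasFDerivAt
        (x := y)).sub_const (x i)).const_mul 2
      simpa using this
    have h2 : HasFDerivAt (fun y => deriv F (‖y - x‖ ^ 2) * (2 * (y - x) i)) _ y :=
      (hcomp hF' y).mul hc
    rw [h1, h2.fderiv]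
    simp [EuclideanSpace.inner_single_right]
    ring
  have hnorm : ‖y - x‖ ^ 2 = ∑ i, (y - x) i ^ 2 := EuclideanSpace.real_norm_sq_eq _
  unfold lapl
  simp_rw [hcoord]
  rw [Finset.sum_add_distrib, ← Finset.mul_sum, ← Finset.mul_sum, ← hnorm]
  simp
  ring

/-- A smooth radial profile `p` together with a compactly supported radial solution `g` of
`Δ (g (‖·‖²)) = p (‖·‖²) - 2ⁿ p (‖2 ·‖²)`. -/
theorem exists_radial_profile (n : ℕ) (hn : 1 ≤ n) :
    ∃ g p : ℝ → ℝ, ContDiff ℝ (⊤ : ℕ∞) g ∧ ContDiff ℝ (⊤ : ℕ∞) p ∧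
      (∀ s, 1 ≤ s → g s = 0) ∧ (∀ s, 1 ≤ s → p s = 0) ∧ (∀ s, 0 ≤ p s) ∧
      (∫ z : EuclideanSpace ℝ (Fin n), p (‖z‖ ^ 2)) = 1 ∧
      ∀ s, 4 * s * deriv (deriv g) s + 2 * n * deriv g s = p s - 2 ^ n * p (4 * s) := by
  set χ : ℝ → ℝ := fun s => Real.smoothTransition (2 * s - 1) with hχ
  have hχs : ContDiff ℝ (⊤ : ℕ∞) χ := Real.smoothTransition.contDiff.comp (by fun_prop)
  have hχ0 : ∀ s, s ≤ 1 / 2 → χ s = 0 := fun s hs =>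
    Real.smoothTransition.zero_of_nonpos (by linarith)
  have hχ1 : ∀ s, 1 ≤ s → χ s = 1 := fun s hs =>
    Real.smoothTransition.one_of_one_le (by linarith)
  have hχm : Monotone χ := fun a b h => Real.smoothTransition.monotone (by linarith)
  have hχ' : ContDiff ℝ (⊤ : ℕ∞) (deriv χ) := (contDiff_infty_iff_deriv.1 hχs).2
  set m : ℝ := (n : ℝ) / 2 with hm
  set q : ℝ → ℝ := fun s => χ s * s ^ (-m) with hq
  have hq0 : ∀ s < (1 / 2 : ℝ), q =ᶠ[nhds s] fun _ => 0 := fun s hs => by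
    filter_upwards [Iio_mem_nhds hs] with t ht
    simp [hq, hχ0 t ht.le]
  have hqs : ContDiff ℝ (⊤ : ℕ∞) q := contDiff_iff_contDiffAt.2 fun s => by
    rcases lt_or_ge s (1 / 2) with hs | hs
    · exact contDiffAt_const.congr_of_eventuallyEq (hq0 s hs)
    · exact hχs.contDiffAt.mul (Real.contDiffAt_rpow_const_of_ne (by linarith))
  have hq' : ContDiff ℝ (⊤ : ℕ∞) (deriv q) := (contDiff_infty_iff_deriv.1 hqs).2
  set p : ℝ → ℝ := fun s => 4 * s * deriv q s + 2 * n * q s with hp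
  have hps : ContDiff ℝ (⊤ : ℕ∞) p := by
    rw [hp]; fun_prop
  have hpval : ∀ s, 1 / 2 ≤ s → p s = 4 * s * s ^ (-m) * deriv χ s := fun s hs => by
    have hs0 : s ≠ 0 := by linarith
    have hd : HasDerivAt q (deriv χ s * s ^ (-m) + χ s * (-m * s ^ (-m - 1))) s :=
      ((hχs.differentiable (by simp)) s).hasDerivAt.mul
        (Real.hasDerivAt_rpow_const (Or.inl hs0))
    simp only [hp, hd.deriv]
    rw [Real.rpow_sub_one hs0, hq, hm]
    field_simp
    ring
  have hpval' : ∀ s < (1 / 2 : ℝ), p s = 0 := fun s hs => by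
    simp [hp, (hq0 s hs).deriv_eq, (hq0 s hs).eq_of_nhds]
  have hχ'0 : ∀ s, 0 ≤ deriv χ s := fun s => hχm.deriv_nonneg
  have hχ'1 : ∀ s, 1 ≤ s → deriv χ s = 0 := by
    have hcl : ∀ s ∈ Ioi (1 : ℝ), deriv χ s = 0 := fun s hs => by
      have : χ =ᶠ[nhds s] fun _ => 1 := by
        filter_upwards [Ioi_mem_nhds hs] with t ht using hχ1 t (le_of_lt ht)
      simp [this.deriv_eq]
    intro s hs
    have hc : IsClosed {s | deriv χ s = 0} := isClosed_eq hχ'.continuous continuous_const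
    exact closure_minimal hcl hc (by rw [closure_Ioi]; exact hs)
  have hp1 : ∀ s, 1 ≤ s → p s = 0 := fun s hs => by
    rw [hpval s (by linarith), hχ'1 s hs, mul_zero]
  have hp0 : ∀ s, 0 ≤ p s := fun s => by
    rcases lt_or_ge s (1 / 2) with hs | hs
    · exact (hpval' s hs).ge
    · rw [hpval s hs]
      have := hχ'0 s
      have h0 : 0 ≤ s := by linarith
      positivity
  have hpne : ∃ s, 1 / 2 ≤ s ∧ p s ≠ 0 := by
    obtain ⟨s, hs, hds⟩ := exists_deriv_eq_slope χ (a := 1 / 2) (b := 1) (by norm_num)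
      hχs.continuous.continuousOn (hχs.differentiable (by simp)).differentiableOn
    refine ⟨s, hs.1.le, ?_⟩
    have h0 : 0 < s := by linarith [hs.1]
    rw [hpval s hs.1.le, hds, hχ1 1 le_rfl, hχ0 _ le_rfl]
    have := Real.rpow_pos_of_pos h0 (-m)
    positivity
  set I : ℝ := ∫ z : EuclideanSpace ℝ (Fin n), p (‖z‖ ^ 2) with hI
  have hIpos : 0 < I := by
    obtain ⟨s, hs, hps0⟩ := hpne
    refine Continuous.integral_pos_of_hasCompactSupport_nonneg_nonzero
      (x := EuclideanSpace.single (⟨0, hn⟩ : Fin n) (Real.sqrt s))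
      (hps.continuous.comp (by fun_prop)) ?_ (fun z => hp0 _) ?_
    · refine HasCompactSupport.intro (isCompact_closedBall 0 1) fun z hz => hp1 _ ?_
      have : 1 < ‖z‖ := by simpa using hz
      nlinarith
    · simpa [Real.sq_sqrt (by linarith : 0 ≤ s)] using hps0
  set d : ℝ → ℝ := fun s => q s - 2 ^ n * q (4 * s) with hd
  have hds : ContDiff ℝ (⊤ : ℕ∞) d := by
    rw [hd]; fun_prop
  have hd1 : ∀ s, 1 ≤ s → d s = 0 := fun s hs => by
    have h4 : (4 : ℝ) ^ (-m) = (2 ^ n)⁻¹ := by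
      rw [show (4 : ℝ) = 2 ^ (2 : ℝ) by norm_num, ← Real.rpow_mul (by norm_num), hm,
        show (2 : ℝ) * -(n / 2) = -n by ring, Real.rpow_neg (by norm_num), Real.rpow_natCast]
    simp only [hd, hq]
    rw [hχ1 s hs, hχ1 (4 * s) (by linarith),
      Real.mul_rpow (by norm_num) (by linarith), h4]
    field_simp
    ring
  set g : ℝ → ℝ := fun s => ∫ t in (1 : ℝ)..s, d t with hg
  have hgd : ∀ s, HasDerivAt g (d s) s := fun s =>
    intervalIntegral.integral_hasDerivAt_right (hds.continuous.intervalIntegrable _ _)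
      (hds.continuous.stronglyMeasurableAtFilter _ _) hds.continuous.continuousAt
  have hgd' : deriv g = d := funext fun s => (hgd s).deriv
  have hgs : ContDiff ℝ (⊤ : ℕ∞) g :=
    contDiff_infty_iff_deriv.2 ⟨fun s => (hgd s).differentiableAt, hgd' ▸ hds⟩
  have hg1 : ∀ s, 1 ≤ s → g s = 0 := fun s hs => by
    simp only [hg]
    rw [intervalIntegral.integral_congr (g := fun _ => 0)]
    · simp
    · intro t ht
      rw [uIcc_of_le hs] at ht
      exact hd1 t ht.1
  have hdd : ∀ s, deriv d s = deriv q s - 2 ^ n * (4 * deriv q (4 * s)) := fun s => by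
    have hqd : ∀ t, HasDerivAt q (deriv q t) t := fun t =>
      ((hqs.differentiable (by simp)) t).hasDerivAt
    have h4 : HasDerivAt (fun s : ℝ => 4 * s) 4 s := by
      simpa using (hasDerivAt_id s).const_mul (4 : ℝ)
    have := (hqd s).sub (((hqd (4 * s)).comp s h4).const_mul (2 ^ n : ℝ))
    rw [mul_comm (4 : ℝ) (deriv q (4 * s))]
    exact this.deriv
  refine ⟨fun s => I⁻¹ * g s, fun s => I⁻¹ * p s, contDiff_const.mul hgs, contDiff_const.mul hps,
    fun s hs => by simp [hg1 s hs], fun s hs => by simp [hp1 s hs],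
    fun s => mul_nonneg (inv_nonneg.2 hIpos.le) (hp0 s), ?_, fun s => ?_⟩
  · rw [integral_const_mul, ← hI, inv_mul_cancel₀ hIpos.ne']
  · have e1 : deriv (fun s => I⁻¹ * g s) = fun s => I⁻¹ * d s := by
      funext t
      exact ((hgd t).const_mul _).deriv
    have e2 : deriv (fun s => I⁻¹ * d s) s = I⁻¹ * deriv d s :=
      ((hds.differentiable (by simp) s).hasDerivAt.const_mul _).deriv
    rw [e1, e2, hdd]
    simp only [hp, hd]
    ring

set_option maxSynthPendingDepth 3

theorem norm_fderiv_add_sub_sub_le {E : Type*} [NormedAddCommGroup E] [NormedSpace ℝ E]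
    {Φ : E → ℝ} (hΦ : ContDiff ℝ (⊤ : ℕ∞) Φ) {L : NNReal}
    (hL : LipschitzWith L (fderiv ℝ (fderiv ℝ Φ))) (z x : E) :
    ‖fderiv ℝ Φ (z + x) - fderiv ℝ Φ z - fderiv ℝ (fderiv ℝ Φ) z x‖ ≤ L * ‖x‖ ^ 2 := by
  have hd : ∀ t ∈ Icc (0 : ℝ) 1, HasDerivWithinAt
      (fun t : ℝ => fderiv ℝ Φ (z + t • x) - t • fderiv ℝ (fderiv ℝ Φ) z x)
      (fderiv ℝ (fderiv ℝ Φ) (z + t • x) x - fderiv ℝ (fderiv ℝ Φ) z x) (Icc 0 1) t := by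
    intro t _
    have hl : HasDerivAt (fun t : ℝ => z + t • x) x t := by
      simpa using ((hasDerivAt_id t).smul_const x).const_add z
    have hb : ContDiff ℝ (⊤ : ℕ∞) (fderiv ℝ Φ) := hΦ.fderiv_right (by simp)
    have h1 := ((hb.differentiable (by simp)) (z + t • x)).hasFDerivAt.comp_hasDerivAt t hl
    have h2 := (hasDerivAt_id t).smul_const (fderiv ℝ (fderiv ℝ Φ) z x)
    exact ((h1.sub h2).congr_deriv (by simp)).hasDerivWithinAt
  have := norm_image_sub_le_of_norm_deriv_le_segment_01' hd (C := L * ‖x‖ ^ 2) fun t ht => by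
    rw [← sub_apply]
    refine (ContinuousLinearMap.le_opNorm _ _).trans ?_
    have h3 := hL.dist_le_mul (z + t • x) z
    rw [dist_eq_norm, dist_eq_norm, add_sub_cancel_left, norm_smul, Real.norm_eq_abs,
      abs_of_nonneg ht.1] at h3
    have h4 : t * ‖x‖ ≤ ‖x‖ := mul_le_of_le_one_left (norm_nonneg _) ht.2.le
    calc _ ≤ (L * ‖x‖) * ‖x‖ := by gcongr; exact h3.trans (by gcongr)
      _ = L * ‖x‖ ^ 2 := by ring
  simpa [sub_right_comm] using this

/-- Second order Taylor expansion with a cubic remainder when the second derivative is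
Lipschitz. -/
theorem abs_sub_taylor_two_le {E : Type*} [NormedAddCommGroup E] [NormedSpace ℝ E]
    {Φ : E → ℝ} (hΦ : ContDiff ℝ (⊤ : ℕ∞) Φ) {L : NNReal}
    (hL : LipschitzWith L (fderiv ℝ (fderiv ℝ Φ))) (z x : E) :
    |Φ (z + x) - (Φ z + fderiv ℝ Φ z x + (2 : ℝ)⁻¹ * fderiv ℝ (fderiv ℝ Φ) z x x)|
      ≤ L * ‖x‖ ^ 3 := by
  have hd : ∀ t ∈ Icc (0 : ℝ) 1, HasDerivWithinAt
      (fun t : ℝ => Φ (z + t • x) - (t * fderiv ℝ Φ z x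
        + t ^ 2 * ((2 : ℝ)⁻¹ * fderiv ℝ (fderiv ℝ Φ) z x x)))
      ((fderiv ℝ Φ (z + t • x) - fderiv ℝ Φ z - fderiv ℝ (fderiv ℝ Φ) z (t • x)) x)
      (Icc 0 1) t := by
    intro t _
    have hl : HasDerivAt (fun t : ℝ => z + t • x) x t := by
      simpa using ((hasDerivAt_id t).smul_const x).const_add z
    have h1 := ((hΦ.differentiable (by simp)) (z + t • x)).hasFDerivAt.comp_hasDerivAt t hl
    have h2 := (hasDerivAt_id t).mul_const (fderiv ℝ Φ z x)
    have h3 := (hasDerivAt_pow 2 t).mul_const ((2 : ℝ)⁻¹ * fderiv ℝ (fderiv ℝ Φ) z x x)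
    refine ((h1.sub (h2.add h3)).congr_deriv ?_).hasDerivWithinAt
    simp
    ring
  have := norm_image_sub_le_of_norm_deriv_le_segment_01' hd (C := L * ‖x‖ ^ 3) fun t ht => by
    refine (ContinuousLinearMap.le_opNorm _ _).trans ?_
    have h3 := norm_fderiv_add_sub_sub_le hΦ hL z (t • x)
    rw [norm_smul, Real.norm_eq_abs, abs_of_nonneg ht.1] at h3
    have h4 : t * ‖x‖ ≤ ‖x‖ := mul_le_of_le_one_left (norm_nonneg _) ht.2.le
    have h5 : 0 ≤ t * ‖x‖ := mul_nonneg ht.1 (norm_nonneg _)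
    calc _ ≤ (L * ‖x‖ ^ 2) * ‖x‖ := by gcongr; exact h3.trans (by gcongr)
      _ = L * ‖x‖ ^ 3 := by ring
  rw [Real.norm_eq_abs] at this
  refine le_of_eq_of_le (congrArg _ ?_) this
  simp
  ring

theorem hasCompactSupport_of_eq_zero_of_one_lt_norm {E V : Type*} [NormedAddCommGroup E]
    [NormedSpace ℝ E] [FiniteDimensional ℝ E] [Zero V] {F : E → V}
    (hF : ∀ z, 1 < ‖z‖ → F z = 0) : HasCompactSupport F :=
  have := FiniteDimensional.proper_real E
  HasCompactSupport.intro (isCompact_closedBall (0 : E) 1) fun z hz => hF z (by simpa using hz)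

/-- Second order Taylor expansion with a uniform cubic remainder for compactly supported smooth
functions. -/
theorem exists_taylor_two_bound {E : Type*} [NormedAddCommGroup E] [NormedSpace ℝ E]
    [FiniteDimensional ℝ E] {Φ : E → ℝ} (hΦ : ContDiff ℝ (⊤ : ℕ∞) Φ)
    (h0 : ∀ z, 1 ≤ ‖z‖ → Φ z = 0) :
    ∃ (A : ℝ) (b : E → E →L[ℝ] ℝ) (q : E → E →L[ℝ] E →L[ℝ] ℝ), 0 ≤ A ∧ Continuous b ∧
      Continuous q ∧ (∀ z, 1 < ‖z‖ → b z = 0) ∧ (∀ z, 1 < ‖z‖ → q z = 0) ∧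
      (∀ z, |Φ z| ≤ A) ∧ (∀ z, ‖b z‖ ≤ A) ∧ (∀ z, ‖q z‖ ≤ A) ∧
      ∀ z x, |Φ (z + x) - (Φ z + b z x + q z x x)| ≤ A * ‖x‖ ^ 3 := by
  have hb : ContDiff ℝ (⊤ : ℕ∞) (fderiv ℝ Φ) := hΦ.fderiv_right (by simp)
  have hq : ContDiff ℝ (⊤ : ℕ∞) (fderiv ℝ (fderiv ℝ Φ)) := hb.fderiv_right (by simp)
  have hev : ∀ z : E, 1 < ‖z‖ → ∀ᶠ w in nhds z, 1 < ‖w‖ := fun z hz =>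
    (isOpen_lt continuous_const continuous_norm).mem_nhds hz
  have hb0 : ∀ z, 1 < ‖z‖ → fderiv ℝ Φ z = 0 := fun z hz => by
    have : Φ =ᶠ[nhds z] fun _ => 0 := (hev z hz).mono fun w hw => h0 w (le_of_lt hw)
    rw [this.fderiv_eq]; simp
  have hq0 : ∀ z, 1 < ‖z‖ → fderiv ℝ (fderiv ℝ Φ) z = 0 := fun z hz => by
    have : fderiv ℝ Φ =ᶠ[nhds z] fun _ => 0 := (hev z hz).mono fun w hw => hb0 w hw
    rw [this.fderiv_eq]; simp
  have hΦc : HasCompactSupport Φ :=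
    hasCompactSupport_of_eq_zero_of_one_lt_norm fun z hz => h0 z hz.le
  obtain ⟨A₀, hA₀⟩ := hΦc.exists_bound_of_continuous hΦ.continuous
  obtain ⟨A₁, hA₁⟩ := (hasCompactSupport_of_eq_zero_of_one_lt_norm hb0).exists_bound_of_continuous hb.continuous
  obtain ⟨A₂, hA₂⟩ := (hasCompactSupport_of_eq_zero_of_one_lt_norm hq0).exists_bound_of_continuous hq.continuous
  obtain ⟨L, hL⟩ := hq.lipschitzWith_of_hasCompactSupport (hasCompactSupport_of_eq_zero_of_one_lt_norm hq0) (by simp)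
  have p0 : 0 ≤ A₀ := (norm_nonneg _).trans (hA₀ 0)
  have p1 : 0 ≤ A₁ := (norm_nonneg _).trans (hA₁ 0)
  have p2 : 0 ≤ A₂ := (norm_nonneg _).trans (hA₂ 0)
  have pL : (0 : ℝ) ≤ L := L.2
  refine ⟨A₀ + A₁ + A₂ + L, fderiv ℝ Φ, fun z => (2 : ℝ)⁻¹ • fderiv ℝ (fderiv ℝ Φ) z,
    by positivity, hb.continuous, by have := hq.continuous; fun_prop, hb0, fun z hz => by simp [hq0 z hz],
    fun z => (hA₀ z).trans (by linarith), fun z => (hA₁ z).trans (by linarith), fun z => ?_,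
    fun z x => ?_⟩
  · rw [norm_smul]
    have := hA₂ z
    have := norm_nonneg (fderiv ℝ (fderiv ℝ Φ) z)
    norm_num
    linarith
  · refine (abs_sub_taylor_two_le hΦ hL z x).trans ?_
    gcongr
    linarith

theorem norm_integral_smul_le_of_ball {n : ℕ} {V : Type*} [NormedAddCommGroup V] [NormedSpace ℝ V]
    {h : EuclideanSpace ℝ (Fin n) → ℝ} {F : EuclideanSpace ℝ (Fin n) → V}
    {z : EuclideanSpace ℝ (Fin n)} {ρ H K : ℝ} (hρ : 0 ≤ ρ)
    (hh : ∀ᵐ y, y ∈ closedBall z ρ → |h y| ≤ H) (hF : ∀ y, ‖F y‖ ≤ K)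
    (hF0 : ∀ y ∉ closedBall z ρ, F y = 0) :
    ‖∫ y, h y • F y‖ ≤
      H * K * (ρ ^ n * volume.real (ball (0 : EuclideanSpace ℝ (Fin n)) 1)) := by
  rw [← setIntegral_eq_integral_of_forall_compl_eq_zero (s := closedBall z ρ)
    fun y hy => by rw [hF0 y hy, smul_zero]]
  have := norm_setIntegral_le_of_norm_le_const_ae' (f := fun y => h y • F y) (C := H * K)
    (measure_closedBall_lt_top (μ := volume) (x := z) (r := ρ)) (by
      filter_upwards [hh] with y hy hyz
      rw [norm_smul]
      exact mul_le_mul (hy hyz) (hF y) (norm_nonneg _) ((abs_nonneg _).trans (hy hyz)))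
  rwa [Measure.addHaar_real_closedBall _ _ hρ, finrank_euclideanSpace_fin] at this

/-- The function `x ↦ ∫ h(y) Φ((x - y) / r) dy` agrees to third order at the origin with a quadratic
polynomial, with bounds that only involve the local size of `h`. -/
theorem exists_quadratic_approx_of_kernel {n : ℕ} {Φ : EuclideanSpace ℝ (Fin n) → ℝ}
    (hΦ : ContDiff ℝ (⊤ : ℕ∞) Φ) (h0 : ∀ z, 1 ≤ ‖z‖ → Φ z = 0) :
    ∃ A : ℝ, 0 ≤ A ∧ ∀ h : EuclideanSpace ℝ (Fin n) → ℝ, Integrable h → ∀ r : ℝ, 0 < r →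
      ∃ (c : ℝ) (b : EuclideanSpace ℝ (Fin n) →L[ℝ] ℝ)
        (Q : EuclideanSpace ℝ (Fin n) →L[ℝ] EuclideanSpace ℝ (Fin n) →L[ℝ] ℝ),
        (∀ H : ℝ, (∀ᵐ y, ‖y‖ ≤ r → |h y| ≤ H) →
          |c| ≤ A * H * r ^ n ∧ ‖b‖ * r ≤ A * H * r ^ n ∧ ‖Q‖ * r ^ 2 ≤ A * H * r ^ n) ∧
        (∀ x ρ H, ‖x‖ + r ≤ ρ → (∀ᵐ y, ‖y‖ ≤ ρ → |h y| ≤ H) →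
          |(∫ y, h y * Φ (r⁻¹ • (x - y))) - (c + b x + Q x x)| ≤
            A * (‖x‖ / r) ^ 3 * H * ρ ^ n) ∧
        (∀ x H, (∀ᵐ y, ‖y‖ ≤ ‖x‖ + r → |h y| ≤ H) →
          |∫ y, h y * Φ (r⁻¹ • (x - y))| ≤ A * H * r ^ n) := by
  obtain ⟨A, b, q, hA, hbc, hqc, hb0, hq0, hΦA, hbA, hqA, htay⟩ := exists_taylor_two_bound hΦ h0
  set ω := volume.real (ball (0 : EuclideanSpace ℝ (Fin n)) 1) with hω
  have hω0 : 0 ≤ ω := measureReal_nonneg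
  refine ⟨A * ω, by positivity, fun h hh r hr => ?_⟩
  have hr' : 0 < r⁻¹ := inv_pos.2 hr
  have hout : ∀ y : EuclideanSpace ℝ (Fin n), y ∉ closedBall (0 : EuclideanSpace ℝ (Fin n)) r →
      1 < ‖r⁻¹ • (-y)‖ := fun y hy => by
    have : r < ‖y‖ := by simpa using hy
    rw [norm_smul, norm_neg, Real.norm_eq_abs, abs_of_pos hr', inv_mul_eq_div, one_lt_div hr]
    exact this
  have hcont : Continuous fun y : EuclideanSpace ℝ (Fin n) => r⁻¹ • (-y) := by fun_prop
  have hcontx : ∀ x, Continuous fun y : EuclideanSpace ℝ (Fin n) => r⁻¹ • (x - y) := fun x => by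
    fun_prop
  have ia : Integrable fun y => h y • Φ (r⁻¹ • (-y)) :=
    hh.smul_bdd A (hΦ.continuous.comp hcont).aestronglyMeasurable (.of_forall fun y => hΦA _)
  have ib : Integrable fun y => h y • b (r⁻¹ • (-y)) :=
    hh.smul_bdd A (hbc.comp hcont).aestronglyMeasurable (.of_forall fun y => hbA _)
  have iq : Integrable fun y => h y • q (r⁻¹ • (-y)) :=
    hh.smul_bdd A (hqc.comp hcont).aestronglyMeasurable (.of_forall fun y => hqA _)
  have iw : ∀ x, Integrable fun y => h y • Φ (r⁻¹ • (x - y)) := fun x =>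
    hh.smul_bdd A (hΦ.continuous.comp (hcontx x)).aestronglyMeasurable
      (.of_forall fun y => hΦA _)
  refine ⟨∫ y, h y • Φ (r⁻¹ • (-y)), r⁻¹ • ∫ y, h y • b (r⁻¹ • (-y)),
    (r⁻¹ ^ 2) • ∫ y, h y • q (r⁻¹ • (-y)), fun H hH => ?_, fun x ρ H hρ hH => ?_,
    fun x H hH => ?_⟩
  · have hH' : ∀ᵐ y, y ∈ closedBall (0 : EuclideanSpace ℝ (Fin n)) r → |h y| ≤ H := by
      simpa using hH
    have e : H * A * (r ^ n * ω) = A * ω * H * r ^ n := by ring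
    refine ⟨?_, ?_, ?_⟩
    · rw [← e]
      exact norm_integral_smul_le_of_ball hr.le hH' (fun y => hΦA _)
        fun y hy => h0 _ (hout y hy).le
    · rw [← e, norm_smul, Real.norm_eq_abs, abs_of_pos hr', mul_right_comm,
        inv_mul_cancel₀ hr.ne', one_mul]
      exact norm_integral_smul_le_of_ball hr.le hH' (fun y => hbA _)
        fun y hy => hb0 _ (hout y hy)
    · rw [← e, norm_smul, Real.norm_eq_abs, abs_of_pos (by positivity), mul_right_comm,
        ← mul_pow, inv_mul_cancel₀ hr.ne', one_pow, one_mul]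
      exact norm_integral_smul_le_of_ball hr.le hH' (fun y => hqA _)
        fun y hy => hq0 _ (hout y hy)
  · have hρ0 : 0 ≤ ρ := by have := norm_nonneg x; linarith
    have hH' : ∀ᵐ y, y ∈ closedBall (0 : EuclideanSpace ℝ (Fin n)) ρ → |h y| ≤ H := by
      simpa using hH
    have iqx : Integrable fun y => (h y • q (r⁻¹ • (-y))) x :=
      (ContinuousLinearMap.apply ℝ _ x).integrable_comp iq
    have ibx : Integrable fun y => r⁻¹ * (h y • b (r⁻¹ • (-y))) x :=
      ((ContinuousLinearMap.apply ℝ ℝ x).integrable_comp ib).const_mul _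
    have iqxx : Integrable fun y => r⁻¹ ^ 2 * (h y • q (r⁻¹ • (-y))) x x :=
      ((ContinuousLinearMap.apply ℝ ℝ x).integrable_comp iqx).const_mul _
    have hbx : (r⁻¹ • ∫ y, h y • b (r⁻¹ • (-y))) x = ∫ y, r⁻¹ * (h y • b (r⁻¹ • (-y))) x := by
      rw [smul_apply, ContinuousLinearMap.integral_apply ib x, smul_eq_mul, integral_const_mul]
    have hqx : ((r⁻¹ ^ 2) • ∫ y, h y • q (r⁻¹ • (-y))) x x =
        ∫ y, r⁻¹ ^ 2 * (h y • q (r⁻¹ • (-y))) x x := by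
      rw [smul_apply, smul_apply, ContinuousLinearMap.integral_apply iq x,
        ContinuousLinearMap.integral_apply iqx x, smul_eq_mul, integral_const_mul]
    have key : (∫ y, h y * Φ (r⁻¹ • (x - y))) - ((∫ y, h y • Φ (r⁻¹ • (-y))) +
        (r⁻¹ • ∫ y, h y • b (r⁻¹ • (-y))) x + ((r⁻¹ ^ 2) • ∫ y, h y • q (r⁻¹ • (-y))) x x) =
        ∫ y, h y • (Φ (r⁻¹ • (-y) + r⁻¹ • x) - (Φ (r⁻¹ • (-y)) + b (r⁻¹ • (-y)) (r⁻¹ • x) +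
          q (r⁻¹ • (-y)) (r⁻¹ • x) (r⁻¹ • x))) := by
      have iab : Integrable fun y => h y • Φ (r⁻¹ • (-y)) + r⁻¹ * (h y • b (r⁻¹ • (-y))) x :=
        ia.add ibx
      have iabq : Integrable fun y => h y • Φ (r⁻¹ • (-y)) + r⁻¹ * (h y • b (r⁻¹ • (-y))) x +
        r⁻¹ ^ 2 * (h y • q (r⁻¹ • (-y))) x x := iab.add iqxx
      rw [hbx, hqx, ← integral_add ia ibx, ← integral_add iab iqxx]
      refine (integral_sub (iw x) iabq).symm.trans ?_
      congr 1
      funext y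
      rw [← smul_add, neg_add_eq_sub]
      simp
      ring
    rw [key]
    have hxr : ‖r⁻¹ • x‖ = ‖x‖ / r := by
      rw [norm_smul, Real.norm_eq_abs, abs_of_pos hr', inv_mul_eq_div]
    have := norm_integral_smul_le_of_ball (K := A * (‖x‖ / r) ^ 3) hρ0 hH'
      (F := fun y => (Φ (r⁻¹ • (-y) + r⁻¹ • x) - (Φ (r⁻¹ • (-y)) + b (r⁻¹ • (-y)) (r⁻¹ • x) +
          q (r⁻¹ • (-y)) (r⁻¹ • x) (r⁻¹ • x)))) (fun y => by
        rw [← hxr]; exact htay _ _) fun y hy => by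
        have hy' : ρ < ‖y‖ := by simpa using hy
        have h1 : 1 < ‖r⁻¹ • (-y)‖ := hout y (by
          have := norm_nonneg x
          simp; linarith)
        have h2 : 1 ≤ ‖r⁻¹ • (-y) + r⁻¹ • x‖ := by
          rw [← smul_add, norm_smul, Real.norm_eq_abs, abs_of_pos hr', inv_mul_eq_div,
            one_le_div hr, neg_add_eq_sub, norm_sub_rev]
          have := norm_sub_norm_le y x
          linarith
        rw [h0 _ h2, h0 _ h1.le, hb0 _ h1, hq0 _ h1]
        simp
    refine this.trans (le_of_eq ?_)
    rw [← hω]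
    ring
  · have hH' : ∀ᵐ y, y ∈ closedBall x r → |h y| ≤ H := by
      filter_upwards [hH] with y hy hyx
      refine hy ?_
      rw [mem_closedBall, dist_eq_norm] at hyx
      have := norm_sub_norm_le y x
      linarith
    have := norm_integral_smul_le_of_ball hr.le hH' (F := fun y => Φ (r⁻¹ • (x - y)))
      (fun y => hΦA _) fun y hy => by
        have hy' : r < ‖x - y‖ := by simpa [dist_eq_norm, norm_sub_rev] using hy
        refine h0 _ ?_
        rw [norm_smul, Real.norm_eq_abs, abs_of_pos hr', inv_mul_eq_div, one_le_div hr]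
        exact hy'.le
    refine this.trans (le_of_eq ?_)
    rw [← hω]
    ring

/-- Summing `min (r ^ α) (t * r ^ (α - 1))` over the dyadic radii `r` yields `O(t ^ α)`. -/
theorem exists_dyadic_sum_bound (α : ℝ) (hα : 0 < α) (hα1 : α < 1) (R : ℝ) (hR : 0 < R) :
    ∃ K : ℝ, 0 ≤ K ∧ ∀ t : ℝ, 0 < t → ∀ N : ℕ,
      ∑ k ∈ Finset.range N, (if R * (1 / 2) ^ k < t then (R * (1 / 2) ^ k : ℝ) ^ α
        else t * (R * (1 / 2) ^ k : ℝ) ^ (α - 1)) ≤ K * t ^ α := by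
  set r : ℕ → ℝ := fun k => R * (1 / 2) ^ k with hr
  have hr0 : ∀ k, 0 < r k := fun k => by simp only [hr]; positivity
  have hrs : ∀ k, r (k + 1) = r k * (1 / 2) := fun k => by simp only [hr]; ring
  have hs : (1 / 2 : ℝ) ^ α < 1 := Real.rpow_lt_one (by norm_num) (by norm_num) hα
  have hl : 1 < (1 / 2 : ℝ) ^ (α - 1) :=
    Real.one_lt_rpow_of_pos_of_lt_one_of_neg (by norm_num) (by norm_num) (by linarith)
  set K₁ : ℝ := (1 - (1 / 2 : ℝ) ^ α)⁻¹ with hK₁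
  set K₂ : ℝ := ((1 / 2 : ℝ) ^ (α - 1) - 1)⁻¹ with hK₂
  have k1 : 0 < K₁ := inv_pos.2 (by linarith)
  have k2 : 0 < K₂ := inv_pos.2 (by linarith)
  refine ⟨K₁ + K₂ * (1 / 2 : ℝ) ^ (α - 1), by positivity, fun t ht N => ?_⟩
  have key : ∑ k ∈ Finset.range N, (if r k < t then r k ^ α else t * r k ^ (α - 1)) ≤
      K₁ * (t ^ α - (min t (r N)) ^ α) + K₂ * (t * (max (t / 2) (r N)) ^ (α - 1)) := by
    induction N with
    | zero =>
      have h1 : (min t (r 0)) ^ α ≤ t ^ α :=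
        Real.rpow_le_rpow (le_min ht.le (hr0 0).le) (min_le_left _ _) hα.le
      have h2 : 0 ≤ max (t / 2) (r 0) := le_max_of_le_right (hr0 0).le
      have h3 : 0 ≤ K₁ * (t ^ α - (min t (r 0)) ^ α) := mul_nonneg k1.le (by linarith)
      rw [Finset.sum_range_zero]
      positivity
    | succ N ih =>
      rw [Finset.sum_range_succ]
      have hrN := hr0 N
      split_ifs with h
      · have e1 : r (N + 1) ≤ t := by rw [hrs]; linarith
        have e2 : max (t / 2) (r (N + 1)) ≤ max (t / 2) (r N) :=
          max_le_max le_rfl (by rw [hrs]; linarith)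
        have e3 : max (t / 2) (r N) ^ (α - 1) ≤ max (t / 2) (r (N + 1)) ^ (α - 1) :=
          Real.rpow_le_rpow_of_nonpos (lt_max_of_lt_left (by linarith)) e2 (by linarith)
        rw [min_eq_right e1]
        rw [min_eq_right h.le] at ih
        have e4 : r (N + 1) ^ α = r N ^ α * (1 / 2) ^ α := by
          rw [hrs, Real.mul_rpow hrN.le (by norm_num)]
        have e5 : K₁ * (r N ^ α - r (N + 1) ^ α) = r N ^ α := by
          rw [e4, hK₁]
          have : 1 - (1 / 2 : ℝ) ^ α ≠ 0 := by linarith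
          field_simp
        have e6 : K₂ * (t * max (t / 2) (r N) ^ (α - 1)) ≤
            K₂ * (t * max (t / 2) (r (N + 1)) ^ (α - 1)) := by gcongr
        linarith
      · have h' : t ≤ r N := not_lt.1 h
        have e1 : t / 2 ≤ r (N + 1) := by rw [hrs]; linarith
        have e2 : t / 2 ≤ r N := by linarith
        rw [max_eq_right e1]
        rw [max_eq_right e2, min_eq_left h'] at ih
        have e3 : (min t (r (N + 1))) ^ α ≤ t ^ α :=
          Real.rpow_le_rpow (le_min ht.le (hr0 _).le) (min_le_left _ _) hα.le
        have e4 : r (N + 1) ^ (α - 1) = r N ^ (α - 1) * (1 / 2) ^ (α - 1) := by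
          rw [hrs, Real.mul_rpow hrN.le (by norm_num)]
        have e5 : K₂ * (t * r (N + 1) ^ (α - 1)) - K₂ * (t * r N ^ (α - 1)) =
            t * r N ^ (α - 1) := by
          rw [e4, hK₂]
          have : (1 / 2 : ℝ) ^ (α - 1) - 1 ≠ 0 := by linarith
          field_simp
        have e6 : 0 ≤ K₁ * (t ^ α - min t (r (N + 1)) ^ α) := mul_nonneg k1.le (by linarith)
        linarith
  refine key.trans ?_
  have f1 : 0 ≤ (min t (r N)) ^ α := Real.rpow_nonneg (le_min ht.le (hr0 _).le) _
  have f2 : max (t / 2) (r N) ^ (α - 1) ≤ (t / 2) ^ (α - 1) :=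
    Real.rpow_le_rpow_of_nonpos (by linarith) (le_max_left _ _) (by linarith)
  have f3 : t * (t / 2) ^ (α - 1) = t ^ α * (1 / 2) ^ (α - 1) := by
    rw [div_eq_mul_one_div, Real.mul_rpow ht.le (by norm_num), ← mul_assoc,
      Real.rpow_sub_one ht.ne']
    field_simp
  calc _ ≤ K₁ * t ^ α + K₂ * (t * (t / 2) ^ (α - 1)) := by
        gcongr
        linarith
    _ = _ := by rw [f3]; ring

/-- The difference of two consecutive dyadic mollifications of `u` is a potential of its
distributional Laplacian. -/
theorem mollification_sub_mollification_half {n : ℕ} {u f : EuclideanSpace ℝ (Fin n) → ℝ}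
    (huf : IsDistribLaplacian u f)
    (hui : Integrable ((ball (0 : EuclideanSpace ℝ (Fin n)) 1).indicator u)) {g p : ℝ → ℝ}
    (hg : ContDiff ℝ (⊤ : ℕ∞) g) (hp : ContDiff ℝ (⊤ : ℕ∞) p) (hg1 : ∀ s, 1 ≤ s → g s = 0)
    (hp1 : ∀ s, 1 ≤ s → p s = 0)
    (hgp : ∀ s, 4 * s * deriv (deriv g) s + 2 * n * deriv g s = p s - 2 ^ n * p (4 * s))
    {x : EuclideanSpace ℝ (Fin n)} {r : ℝ} (hr : 0 < r) (hxr : ‖x‖ + r < 1) :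
    (r ^ n)⁻¹ * (∫ y, (ball (0 : EuclideanSpace ℝ (Fin n)) 1).indicator u y *
        p (‖r⁻¹ • (x - y)‖ ^ 2)) -
      ((r * (1 / 2)) ^ n)⁻¹ * (∫ y, (ball (0 : EuclideanSpace ℝ (Fin n)) 1).indicator u y *
        p (‖(r * (1 / 2))⁻¹ • (x - y)‖ ^ 2)) =
      r ^ 2 * (r ^ n)⁻¹ * (∫ y, (ball (0 : EuclideanSpace ℝ (Fin n)) 1).indicator f y *
        g (‖r⁻¹ • (x - y)‖ ^ 2)) := by
  set F : ℝ → ℝ := fun s => r ^ 2 * (r ^ n)⁻¹ * g ((r ^ 2)⁻¹ * s) with hF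
  have hFs : ContDiff ℝ (⊤ : ℕ∞) F := by
    rw [hF]; fun_prop
  have hscale : ∀ s : ℝ, HasDerivAt (fun s : ℝ => (r ^ 2)⁻¹ * s) (r ^ 2)⁻¹ s := fun s => by
    simpa using (hasDerivAt_id s).const_mul (r ^ 2)⁻¹
  have hF1 : deriv F = fun s => (r ^ n)⁻¹ * deriv g ((r ^ 2)⁻¹ * s) := by
    funext s
    have h1 := ((hg.differentiable (by simp)) ((r ^ 2)⁻¹ * s)).hasDerivAt
    have h2 : HasDerivAt F _ s := (h1.comp s (hscale s)).const_mul (r ^ 2 * (r ^ n)⁻¹)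
    rw [h2.deriv]
    field_simp
  have hg' : ContDiff ℝ (⊤ : ℕ∞) (deriv g) := (contDiff_infty_iff_deriv.1 hg).2
  have hF2 : ∀ s, deriv (deriv F) s = (r ^ n)⁻¹ * (r ^ 2)⁻¹ * deriv (deriv g) ((r ^ 2)⁻¹ * s) := by
    intro s
    have h1 := ((hg'.differentiable (by simp)) ((r ^ 2)⁻¹ * s)).hasDerivAt
    have h2 : HasDerivAt (fun s => (r ^ n)⁻¹ * deriv g ((r ^ 2)⁻¹ * s)) _ s :=
      (h1.comp s (hscale s)).const_mul (r ^ n)⁻¹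
    rw [hF1, h2.deriv]
    ring
  have hsq : ∀ y, ‖r⁻¹ • (x - y)‖ ^ 2 = (r ^ 2)⁻¹ * ‖y - x‖ ^ 2 := fun y => by
    rw [norm_smul, mul_pow, norm_sub_rev, norm_inv, Real.norm_eq_abs, inv_pow, sq_abs]
  have hsq' : ∀ y, ‖(r * (1 / 2))⁻¹ • (x - y)‖ ^ 2 = 4 * ((r ^ 2)⁻¹ * ‖y - x‖ ^ 2) := fun y => by
    rw [norm_smul, mul_pow, norm_sub_rev, norm_inv, Real.norm_eq_abs, inv_pow, sq_abs]
    field_simp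
    ring
  have hlap : ∀ y, lapl (fun y => F (‖y - x‖ ^ 2)) y = (r ^ n)⁻¹ * p (‖r⁻¹ • (x - y)‖ ^ 2) -
      ((r * (1 / 2)) ^ n)⁻¹ * p (‖(r * (1 / 2))⁻¹ • (x - y)‖ ^ 2) := fun y => by
    rw [lapl_comp_norm_sub_sq hFs, hF2, hF1, hsq, hsq']
    have h1 := hgp ((r ^ 2)⁻¹ * ‖y - x‖ ^ 2)
    have h2 : ((r * (1 / 2)) ^ n)⁻¹ = (r ^ n)⁻¹ * 2 ^ n := by
      rw [mul_pow, mul_inv, one_div, inv_pow, inv_inv]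
    rw [h2]
    linear_combination (r ^ n)⁻¹ * h1
  have hsupp : ∀ y ∉ closedBall x r, F (‖y - x‖ ^ 2) = 0 := fun y hy => by
    have hy' : r < ‖y - x‖ := by simpa [dist_eq_norm] using hy
    rw [hF]
    simp only
    rw [hg1, mul_zero]
    rw [inv_mul_eq_div, one_le_div (by positivity)]
    gcongr
  have hts : tsupport (fun y => F (‖y - x‖ ^ 2)) ⊆ closedBall x r :=
    closure_minimal (fun y hy => by_contra fun h => hy (hsupp y h)) isClosed_closedBall
  have hsmooth : ContDiff ℝ (⊤ : ℕ∞) fun y : EuclideanSpace ℝ (Fin n) => F (‖y - x‖ ^ 2) :=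
    hFs.comp ((contDiff_id.sub contDiff_const).norm_sq ℝ)
  have hmain := huf _ hsmooth (HasCompactSupport.intro (isCompact_closedBall x r) hsupp)
    (hts.trans fun y hy => by
      rw [mem_closedBall, dist_eq_norm] at hy
      rw [mem_ball_zero_iff]
      have := norm_sub_norm_le y x
      linarith)
  have hind : ∀ h k : EuclideanSpace ℝ (Fin n) → ℝ,
      ∫ y in ball (0 : EuclideanSpace ℝ (Fin n)) 1, h y * k y =
        ∫ y, (ball (0 : EuclideanSpace ℝ (Fin n)) 1).indicator h y * k y := fun h k => by
    rw [← integral_indicator measurableSet_ball]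
    simp_rw [indicator_mul_left]
  have hint : ∀ ρ : ℝ, Integrable fun y =>
      (ball (0 : EuclideanSpace ℝ (Fin n)) 1).indicator u y * p (‖ρ⁻¹ • (x - y)‖ ^ 2) := fun ρ => by
    have hcs : HasCompactSupport fun z : EuclideanSpace ℝ (Fin n) => p (‖z‖ ^ 2) :=
      hasCompactSupport_of_eq_zero_of_one_lt_norm fun z hz => hp1 _ (by nlinarith)
    have hc : Continuous fun z : EuclideanSpace ℝ (Fin n) => p (‖z‖ ^ 2) :=
      hp.continuous.comp (by fun_prop)
    obtain ⟨A, hA⟩ := hcs.exists_bound_of_continuous hc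
    exact hui.smul_bdd A (hc.comp (by fun_prop : Continuous fun y => ρ⁻¹ • (x - y))
      ).aestronglyMeasurable (.of_forall fun y => hA _)
  rw [hind, hind] at hmain
  rw [← integral_const_mul, ← integral_const_mul, ← integral_const_mul,
    ← integral_sub ((hint _).const_mul _) ((hint _).const_mul _)]
  refine (integral_congr_ae (.of_forall fun y => ?_)).trans
    (hmain.trans (integral_congr_ae (.of_forall fun y => ?_)))
  · simp only [hlap]
    ring
  · simp only [hF, hsq]
    ring

theorem tendsto_mollification {n : ℕ} {w : EuclideanSpace ℝ (Fin n) → ℝ} (hw : Integrable w)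
    {p : ℝ → ℝ} (hp1 : ∀ s, 1 ≤ s → p s = 0) (hp0 : ∀ s, 0 ≤ p s)
    (hpI : (∫ z : EuclideanSpace ℝ (Fin n), p (‖z‖ ^ 2)) = 1)
    {x : EuclideanSpace ℝ (Fin n)} (hx : ContinuousAt w x) {r : ℕ → ℝ} (hr : ∀ k, 0 < r k)
    (hr0 : Filter.Tendsto r Filter.atTop (nhds 0)) :
    Filter.Tendsto (fun k => (r k ^ n)⁻¹ * ∫ y, w y * p (‖(r k)⁻¹ • (x - y)‖ ^ 2)) Filter.atTop
      (nhds (w x)) := by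
  have := convolution_tendsto_right (μ := volume) (l := Filter.atTop) (x₀ := x) (z₀ := w x)
    (φ := fun k z => (r k ^ n)⁻¹ * p (‖(r k)⁻¹ • z‖ ^ 2)) (g := fun _ => w) (k := fun _ => x)
    (.of_forall fun k z => mul_nonneg (by have := hr k; positivity) (hp0 _))
    (.of_forall fun k => by
      rw [integral_const_mul, Measure.integral_comp_inv_smul_of_nonneg volume
        (fun z : EuclideanSpace ℝ (Fin n) => p (‖z‖ ^ 2)) (hr k).le, hpI,
        finrank_euclideanSpace_fin, smul_eq_mul, mul_one]
      exact inv_mul_cancel₀ (pow_ne_zero _ (hr k).ne'))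
    (by
      rw [Filter.tendsto_smallSets_iff]
      intro s hs
      obtain ⟨ε, hε, hεs⟩ := Metric.mem_nhds_iff.1 hs
      filter_upwards [hr0.eventually (gt_mem_nhds hε)] with k hk
      refine fun z hz => hεs ?_
      rw [mem_ball_zero_iff]
      by_contra! hzε
      refine hz ?_
      simp only
      rw [hp1, mul_zero]
      have h1 : 1 ≤ ‖(r k)⁻¹ • z‖ := by
        rw [norm_smul, norm_inv, Real.norm_eq_abs, abs_of_pos (hr k), inv_mul_eq_div,
          one_le_div (hr k)]
        linarith
      nlinarith)
    (.of_forall fun _ => hw.aestronglyMeasurable)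
    (hx.tendsto.comp Filter.tendsto_snd) tendsto_const_nhds
  refine this.congr fun k => ?_
  rw [convolution_def, ← integral_sub_left_eq_self _ volume x, ← integral_const_mul]
  refine integral_congr_ae (.of_forall fun y => ?_)
  simp
  ring

/-- The error of a quadratic approximation at scale `r`, in terms of the ratio of `‖x‖` to `r`. -/
theorem abs_rescaled_sub_quadratic_le {n : ℕ} {A M α r : ℝ} (hα : 0 < α) (hα1 : α < 1) (hA : 0 ≤ A)
    (hM : 0 ≤ M) (hr : 0 < r) {W : EuclideanSpace ℝ (Fin n) → ℝ} {c : ℝ}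
    {b : EuclideanSpace ℝ (Fin n) →L[ℝ] ℝ}
    {Q : EuclideanSpace ℝ (Fin n) →L[ℝ] EuclideanSpace ℝ (Fin n) →L[ℝ] ℝ}
    (hc : |c| ≤ A * (M * r ^ α) * r ^ n) (hb : ‖b‖ * r ≤ A * (M * r ^ α) * r ^ n)
    (hQ : ‖Q‖ * r ^ 2 ≤ A * (M * r ^ α) * r ^ n)
    (hnear : ∀ x, ‖x‖ ≤ r → |W x - (c + b x + Q x x)| ≤
      A * (‖x‖ / r) ^ 3 * (M * (2 * r) ^ α) * (2 * r) ^ n)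
    (hfar : ∀ x, |W x| ≤ A * (M * (‖x‖ + r) ^ α) * r ^ n) (x : EuclideanSpace ℝ (Fin n)) :
    |r ^ 2 * (r ^ n)⁻¹ * (W x - (c + b x + Q x x))| ≤
      A * (2 * 2 ^ n + 5) * M * ‖x‖ ^ 2 *
        (if r < ‖x‖ then r ^ α else ‖x‖ * r ^ (α - 1)) := by
  have hrn : 0 < r ^ n := pow_pos hr n
  have hrα : 0 ≤ r ^ α := Real.rpow_nonneg hr.le _
  have h2α : (2 : ℝ) ^ α ≤ 2 := by
    simpa using Real.rpow_le_rpow_of_exponent_le (x := 2) (by norm_num) hα1.le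
  rw [abs_mul, abs_of_pos (by positivity)]
  split_ifs with h
  · set t := ‖x‖ with ht
    have ht0 : 0 < t := hr.trans h
    have hbx : |b x| ≤ ‖b‖ * t := b.le_opNorm x
    have hQx : |Q x x| ≤ ‖Q‖ * t * t := Q.le_opNorm₂ x x
    have hswap : t ^ α * r ^ 2 ≤ r ^ α * t ^ 2 := by
      have e : ∀ s : ℝ, 0 < s → s ^ 2 = s ^ α * s ^ (2 - α) := fun s hs => by
        rw [← Real.rpow_add hs, add_sub_cancel, Real.rpow_two]
      rw [e r hr, e t ht0]
      have := Real.rpow_le_rpow hr.le h.le (by linarith : 0 ≤ 2 - α)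
      calc t ^ α * (r ^ α * r ^ (2 - α)) ≤ t ^ α * (r ^ α * t ^ (2 - α)) := by gcongr
        _ = _ := by ring
    have hW : |W x| ≤ A * (M * (2 * t ^ α)) * r ^ n := by
      refine (hfar x).trans ?_
      gcongr
      calc (t + r) ^ α ≤ (2 * t) ^ α := by gcongr; linarith
        _ = 2 ^ α * t ^ α := Real.mul_rpow (by norm_num) ht0.le
        _ ≤ 2 * t ^ α := by gcongr
    have htri : |W x - (c + b x + Q x x)| ≤ |W x| + |c| + |b x| + |Q x x| := by
      have a1 := abs_sub (W x) (c + b x + Q x x)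
      have a2 := abs_add_le (c + b x) (Q x x)
      have a3 := abs_add_le c (b x)
      linarith
    have b1 : r ^ 2 * (r ^ n)⁻¹ * |W x| ≤ 2 * (A * M * (r ^ α * t ^ 2)) := by
      calc _ ≤ r ^ 2 * (r ^ n)⁻¹ * (A * (M * (2 * t ^ α)) * r ^ n) := by gcongr
        _ = 2 * (A * M * (t ^ α * r ^ 2)) := by field_simp
        _ ≤ _ := by gcongr
    have b2 : r ^ 2 * (r ^ n)⁻¹ * |c| ≤ A * M * (r ^ α * t ^ 2) := by
      calc _ ≤ r ^ 2 * (r ^ n)⁻¹ * (A * (M * r ^ α) * r ^ n) := by gcongr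
        _ = A * M * (r ^ α * r ^ 2) := by field_simp
        _ ≤ _ := by gcongr
    have b3 : r ^ 2 * (r ^ n)⁻¹ * |b x| ≤ A * M * (r ^ α * t ^ 2) := by
      calc _ ≤ r ^ 2 * (r ^ n)⁻¹ * (‖b‖ * t) := by gcongr
        _ = r * (r ^ n)⁻¹ * (‖b‖ * r) * t := by ring
        _ ≤ r * (r ^ n)⁻¹ * (A * (M * r ^ α) * r ^ n) * t := by gcongr
        _ = A * M * (r ^ α * (r * t)) := by field_simp
        _ ≤ _ := by
          rw [sq]
          gcongr
    have b4 : r ^ 2 * (r ^ n)⁻¹ * |Q x x| ≤ A * M * (r ^ α * t ^ 2) := by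
      calc _ ≤ r ^ 2 * (r ^ n)⁻¹ * (‖Q‖ * t * t) := by gcongr
        _ = (r ^ n)⁻¹ * (‖Q‖ * r ^ 2) * t ^ 2 := by ring
        _ ≤ (r ^ n)⁻¹ * (A * (M * r ^ α) * r ^ n) * t ^ 2 := by gcongr
        _ = _ := by field_simp
    have b5 : 0 ≤ A * (2 * 2 ^ n) * M * t ^ 2 * r ^ α := by positivity
    calc _ ≤ r ^ 2 * (r ^ n)⁻¹ * (|W x| + |c| + |b x| + |Q x x|) := by gcongr
      _ ≤ 5 * (A * M * (r ^ α * t ^ 2)) := by linarith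
      _ ≤ _ := by linarith
  · have h' : ‖x‖ ≤ r := not_lt.1 h
    have e1 : (2 * r) ^ α ≤ 2 * r ^ α := by
      rw [Real.mul_rpow (by norm_num) hr.le]
      gcongr
    calc _ ≤ r ^ 2 * (r ^ n)⁻¹ * (A * (‖x‖ / r) ^ 3 * (M * (2 * r ^ α)) * (2 * r) ^ n) := by
          gcongr
          exact (hnear x h').trans (by gcongr)
      _ = A * (2 * 2 ^ n) * M * ‖x‖ ^ 2 * (‖x‖ * r ^ (α - 1)) := by
          rw [Real.rpow_sub_one hr.ne', mul_pow]
          field_simp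
      _ ≤ _ := by
          gcongr
          linarith

/-- pointwise `C^{2,α}` Schauder estimate at the origin, Laplacian
case. If `Δu = f` distributionally with `|f(x)| ≤ M|x|^α` a.e., then there is a
polynomial `P` of degree at most `2` with
`|u(x) − P(x)| ≤ C(n,α)(M + sup_{B₁}|u|)|x|^{2+α}` on `B_{1/2}`. -/
theorem pointwise_schauder_at_origin (n : ℕ) (hn : 1 ≤ n) (α : ℝ) (hα : 0 < α) (hα1 : α < 1) :
    ∃ C : ℝ,
      ∀ (M : ℝ) (u f : EuclideanSpace ℝ (Fin n) → ℝ), 0 ≤ M →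
      ContinuousOn u (ball (0 : EuclideanSpace ℝ (Fin n)) 1) →
      (∃ B : ℝ, ∀ x ∈ ball (0 : EuclideanSpace ℝ (Fin n)) 1, |u x| ≤ B) →
      Measurable f →
      (∀ᵐ x ∂(volume.restrict (ball (0 : EuclideanSpace ℝ (Fin n)) 1)),
        |f x| ≤ M * ‖x‖ ^ α) →
      IsDistribLaplacian u f →
      ∃ (c : ℝ) (b : EuclideanSpace ℝ (Fin n) →L[ℝ] ℝ)
        (Q : EuclideanSpace ℝ (Fin n) →L[ℝ] EuclideanSpace ℝ (Fin n) →L[ℝ] ℝ),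
        ∀ x ∈ ball (0 : EuclideanSpace ℝ (Fin n)) (1/2),
          |u x - (c + b x + Q x x)| ≤
            C * (M + ⨆ y ∈ ball (0 : EuclideanSpace ℝ (Fin n)) 1, |u y|) *
              ‖x‖ ^ (2 + α) := by
  obtain ⟨g, p, hg, hp, hg1, hp1, hp0, hpI, hgp⟩ := exists_radial_profile n hn
  have hnsq : ContDiff ℝ (⊤ : ℕ∞) fun z : EuclideanSpace ℝ (Fin n) => ‖z‖ ^ 2 :=
    contDiff_norm_sq ℝ
  obtain ⟨A, hA, hAg⟩ := exists_quadratic_approx_of_kernel (n := n) (hg.comp hnsq)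
    fun z hz => hg1 _ (one_le_pow₀ hz)
  obtain ⟨A', hA', hAp⟩ := exists_quadratic_approx_of_kernel (n := n) (hp.comp hnsq)
    fun z hz => hp1 _ (one_le_pow₀ hz)
  simp only [Function.comp_apply] at hAg hAp
  obtain ⟨K, hK, hsum⟩ := exists_dyadic_sum_bound α hα hα1 (1 / 4) (by norm_num)
  refine ⟨A' * 64 * 4 ^ n + A * (2 * 2 ^ n + 5) * K, fun M u f hM hu hB hf hfM huf => ?_⟩
  set U := ball (0 : EuclideanSpace ℝ (Fin n)) 1 with hU
  set S : ℝ := ⨆ y ∈ U, |u y| with hS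
  have huS : ∀ y ∈ U, |u y| ≤ S := by
    obtain ⟨B, hB⟩ := hB
    have hbdd : BddAbove (range fun y => ⨆ _ : y ∈ U, |u y|) := by
      refine ⟨max B 0, ?_⟩
      rintro _ ⟨y, rfl⟩
      exact Real.iSup_le (fun hy => (hB y hy).trans (le_max_left _ _)) (le_max_right _ _)
    intro y hy
    have := le_ciSup hbdd y
    rwa [ciSup_pos hy] at this
  have hS0 : 0 ≤ S := Real.iSup_nonneg fun y => Real.iSup_nonneg fun _ => abs_nonneg _
  have hUfin : volume U < ⊤ := measure_ball_lt_top
  have hui : Integrable (U.indicator u) := by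
    rw [integrable_indicator_iff measurableSet_ball]
    exact IntegrableOn.of_bound hUfin (hu.aestronglyMeasurable measurableSet_ball)
      S ((ae_restrict_iff' measurableSet_ball).2 (.of_forall huS))
  have hfM' : ∀ᵐ y, |U.indicator f y| ≤ M * ‖y‖ ^ α := by
    filter_upwards [(ae_restrict_iff' measurableSet_ball).1 hfM] with y hy
    by_cases hyU : y ∈ U
    · rw [indicator_of_mem hyU]
      exact hy hyU
    · rw [indicator_of_notMem hyU, abs_zero]
      positivity
  have hfi : Integrable (U.indicator f) := by
    rw [integrable_indicator_iff measurableSet_ball]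
    refine Measure.integrableOn_of_bounded hUfin.ne
      hf.aestronglyMeasurable
      (M := M) ((ae_restrict_iff' measurableSet_ball).2 ?_)
    filter_upwards [(ae_restrict_iff' measurableSet_ball).1 hfM] with y hy hyU
    refine (hy hyU).trans (mul_le_of_le_one_right hM ?_)
    exact Real.rpow_le_one (norm_nonneg _) (mem_ball_zero_iff.1 hyU).le hα.le
  have hfρ : ∀ ρ : ℝ, ∀ᵐ y, ‖y‖ ≤ ρ → |U.indicator f y| ≤ M * ρ ^ α := fun ρ => by
    filter_upwards [hfM'] with y hy hyρ
    refine hy.trans ?_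
    gcongr
  set r : ℕ → ℝ := fun k => 1 / 4 * (1 / 2) ^ k with hr
  have hr0 : ∀ k, 0 < r k := fun k => by simp only [hr]; positivity
  have hr4 : ∀ k, r k ≤ 1 / 4 := fun k =>
    mul_le_of_le_one_right (by norm_num) (pow_le_one₀ (by norm_num) (by norm_num))
  have hrs : ∀ k, r (k + 1) = r k * (1 / 2) := fun k => by simp only [hr]; ring
  have hrt : Filter.Tendsto r Filter.atTop (nhds 0) := by
    have := (tendsto_pow_atTop_nhds_zero_of_lt_one (r := (1 / 2 : ℝ)) (by norm_num)
      (by norm_num)).const_mul (1 / 4)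
    rwa [mul_zero] at this
  choose c b Q hcbQ hnear hfar using fun k => hAg _ hfi (r k) (hr0 k)
  obtain ⟨c₀, b₀, Q₀, -, hnear₀, -⟩ := hAp _ hui (1 / 4) (by norm_num)
  set κ : ℕ → ℝ := fun k => r k ^ 2 * (r k ^ n)⁻¹ with hκ
  have hκ0 : ∀ k, 0 ≤ κ k := fun k => by have := hr0 k; simp only [hκ]; positivity
  have hrα : Summable fun k => A * M * r k ^ α := by
    refine Summable.mul_left _ ?_
    have e : (fun k => r k ^ α) = fun k => (1 / 4 : ℝ) ^ α * ((1 / 2 : ℝ) ^ α) ^ k := by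
      funext k
      rw [hr, Real.mul_rpow (by norm_num) (by positivity), Real.rpow_pow_comm (by norm_num)]
    rw [e]
    exact (summable_geometric_of_lt_one (by positivity)
      (Real.rpow_lt_one (by norm_num) (by norm_num) hα)).mul_left _
  have hcoef : ∀ (k m : ℕ) (s : ℝ), 0 ≤ s → m ≤ 2 →
      s * r k ^ m ≤ A * (M * r k ^ α) * r k ^ n → κ k * s ≤ A * M * r k ^ α := by
    intro k m s hs hm h
    have h0 := hr0 k
    have h1 : r k ^ (2 - m) ≤ 1 := pow_le_one₀ h0.le (by linarith [hr4 k])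
    have h2 : r k ^ 2 = r k ^ (2 - m) * r k ^ m := by rw [← pow_add, Nat.sub_add_cancel hm]
    calc κ k * s = r k ^ (2 - m) * (r k ^ n)⁻¹ * (s * r k ^ m) := by
          simp only [hκ]; rw [h2]; ring
      _ ≤ 1 * (r k ^ n)⁻¹ * (A * (M * r k ^ α) * r k ^ n) := by gcongr
      _ = _ := by field_simp
  have hcs : Summable fun k => κ k * c k := .of_norm_bounded hrα fun k => by
    rw [norm_mul, Real.norm_of_nonneg (hκ0 k)]
    exact hcoef k 0 _ (norm_nonneg _) (by norm_num)
      (by simpa using (hcbQ k _ (hfρ _)).1)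
  have hbs : Summable fun k => κ k • b k := .of_norm_bounded hrα fun k => by
    rw [norm_smul, Real.norm_of_nonneg (hκ0 k)]
    exact hcoef k 1 _ (norm_nonneg _) (by norm_num)
      (by simpa using (hcbQ k _ (hfρ _)).2.1)
  have hQs : Summable fun k => κ k • Q k := .of_norm_bounded hrα fun k => by
    rw [norm_smul, Real.norm_of_nonneg (hκ0 k)]
    exact hcoef k 2 _ (norm_nonneg _) le_rfl (hcbQ k _ (hfρ _)).2.2
  set κ₀ : ℝ := ((1 / 4 : ℝ) ^ n)⁻¹ with hκ₀
  have hκ₀4 : κ₀ = 4 ^ n := by rw [hκ₀, one_div, inv_pow, inv_inv]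
  refine ⟨κ₀ * c₀ - ∑' k, κ k * c k, κ₀ • b₀ - ∑' k, κ k • b k, κ₀ • Q₀ - ∑' k, κ k • Q k,
    fun x hx => ?_⟩
  have hx2 : ‖x‖ < 1 / 2 := mem_ball_zero_iff.1 hx
  have hxU : x ∈ U := mem_ball_zero_iff.2 (by linarith)
  set V : ℕ → ℝ := fun k => (r k ^ n)⁻¹ * ∫ y, U.indicator u y * p (‖(r k)⁻¹ • (x - y)‖ ^ 2)
    with hV
  set W : ℕ → EuclideanSpace ℝ (Fin n) → ℝ := fun k x =>
    ∫ y, U.indicator f y * g (‖(r k)⁻¹ • (x - y)‖ ^ 2) with hW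
  have hVu : Filter.Tendsto V Filter.atTop (nhds (u x)) := by
    have hev : U.indicator u =ᶠ[nhds x] u := by
      filter_upwards [isOpen_ball.mem_nhds hxU] with y hy using indicator_of_mem hy u
    have hcx : ContinuousAt (U.indicator u) x :=
      (hu.continuousAt (isOpen_ball.mem_nhds hxU)).congr hev.symm
    have := tendsto_mollification hui hp1 hp0 hpI hcx hr0 hrt
    rwa [indicator_of_mem hxU] at this
  have hVW : ∀ N, V N = V 0 - ∑ k ∈ Finset.range N, κ k * W k x := by
    intro N
    induction N with
    | zero => simp
    | succ N ih =>
      rw [Finset.sum_range_succ, ← sub_sub, ← ih]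
      have := mollification_sub_mollification_half huf hui hg hp hg1 hp1 hgp (hr0 N)
        (by linarith [hr4 N] : ‖x‖ + r N < 1)
      rw [← hrs] at this
      simp only [hV, hκ, hW]
      linarith
  have hlim : Filter.Tendsto (fun N => (V 0 - κ₀ * (c₀ + b₀ x + Q₀ x x)) -
      ∑ k ∈ Finset.range N, κ k * (W k x - (c k + b k x + Q k x x))) Filter.atTop
      (nhds (u x - ((κ₀ * c₀ - ∑' k, κ k * c k) + (κ₀ • b₀ - ∑' k, κ k • b k) x +
        (κ₀ • Q₀ - ∑' k, κ k • Q k) x x))) := by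
    have l1 := hcs.hasSum.tendsto_sum_nat
    have l2 := (hbs.hasSum.mapL (ContinuousLinearMap.apply ℝ ℝ x)).tendsto_sum_nat
    have l3 := ((hQs.hasSum.mapL (ContinuousLinearMap.apply ℝ _ x)).mapL
      (ContinuousLinearMap.apply ℝ ℝ x)).tendsto_sum_nat
    have l4 := hVu.sub ((((tendsto_const_nhds (x := κ₀ * c₀)).sub l1).add
      ((tendsto_const_nhds (x := κ₀ * b₀ x)).sub l2)).add
      ((tendsto_const_nhds (x := κ₀ * Q₀ x x)).sub l3))
    refine (l4.congr fun N => ?_).trans (le_of_eq (congrArg _ ?_))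
    · rw [hVW N]
      simp only [ContinuousLinearMap.apply_apply, smul_apply, smul_eq_mul, mul_sub, mul_add,
        Finset.sum_sub_distrib, Finset.sum_add_distrib]
      ring
    · simp
  have hterm : ∀ k, |κ k * (W k x - (c k + b k x + Q k x x))| ≤
      A * (2 * 2 ^ n + 5) * M * ‖x‖ ^ 2 *
        (if r k < ‖x‖ then r k ^ α else ‖x‖ * r k ^ (α - 1)) := fun k =>
    abs_rescaled_sub_quadratic_le hα hα1 hA hM (hr0 k) (hcbQ k _ (hfρ _)).1
      (hcbQ k _ (hfρ _)).2.1 (hcbQ k _ (hfρ _)).2.2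
      (fun z hz => hnear k z _ _ (by linarith) (hfρ _)) (fun z => hfar k z _ (hfρ _)) x
  have hpow : ‖x‖ ^ 2 * ‖x‖ ^ α = ‖x‖ ^ (2 + α) := by
    rw [Real.rpow_add_of_nonneg (norm_nonneg _) (by norm_num) hα.le, Real.rpow_two]
  have hsumx : ∀ N, |∑ k ∈ Finset.range N, κ k * (W k x - (c k + b k x + Q k x x))| ≤
      A * (2 * 2 ^ n + 5) * K * M * ‖x‖ ^ (2 + α) := by
    intro N
    refine (Finset.abs_sum_le_sum_abs _ _).trans ((Finset.sum_le_sum fun k _ => hterm k).trans ?_)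
    rw [← Finset.mul_sum, ← hpow]
    rcases (norm_nonneg x).eq_or_lt with h | h
    · simp [← h]
    · calc _ ≤ A * (2 * 2 ^ n + 5) * M * ‖x‖ ^ 2 * (K * ‖x‖ ^ α) := by
            gcongr
            exact hsum _ h N
        _ = _ := by ring
  have hV0 : |V 0 - κ₀ * (c₀ + b₀ x + Q₀ x x)| ≤ A' * 64 * 4 ^ n * S * ‖x‖ ^ (2 + α) := by
    have h1 := hnear₀ x 1 S (by linarith) (.of_forall fun y _ => by
      by_cases hyU : y ∈ U
      · rw [indicator_of_mem hyU]
        exact huS y hyU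
      · rw [indicator_of_notMem hyU, abs_zero]
        exact hS0)
    have hr00 : r 0 = 1 / 4 := by simp [hr]
    simp only [hV]
    rw [hr00, ← hκ₀, ← mul_sub, abs_mul, hκ₀4, abs_of_pos (by positivity)]
    have h3 : ‖x‖ ^ 3 ≤ ‖x‖ ^ (2 + α) := by
      rw [← hpow, pow_succ]
      gcongr
      simpa using Real.rpow_le_rpow_of_exponent_ge_of_imp (norm_nonneg x) (by linarith) hα1.le
        (by intro _ h; linarith)
    calc _ ≤ 4 ^ n * (A' * (‖x‖ / (1 / 4)) ^ 3 * S * 1 ^ n) := by gcongr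
      _ = A' * 64 * 4 ^ n * S * ‖x‖ ^ 3 := by
          rw [one_pow]
          ring
      _ ≤ _ := by gcongr
  refine le_of_tendsto hlim.abs (.of_forall fun N => ?_)
  have hX : 0 ≤ ‖x‖ ^ (2 + α) := by positivity
  have q1 : 0 ≤ A' * 64 * 4 ^ n * M * ‖x‖ ^ (2 + α) := by positivity
  have q2 : 0 ≤ A * (2 * 2 ^ n + 5) * K * S * ‖x‖ ^ (2 + α) := by positivity
  calc _ ≤ _ := abs_sub _ _
    _ ≤ A' * 64 * 4 ^ n * S * ‖x‖ ^ (2 + α) +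
        A * (2 * 2 ^ n + 5) * K * M * ‖x‖ ^ (2 + α) := add_le_add hV0 (hsumx N)
    _ ≤ _ := by linarith
end
end
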